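/- Let α ∈ (0,1), let μ be an α-irrigable positive bounded Radon measure on ℝ^d with landscape function Z associated to an optimal irrigation plan, and let g be a measurable function with |g| ≤ 1 μ-almost everywhere. Then the positive measure ν = (1 + g)μ satisfies I^α(ν) ≤ I^α(μ) + α·∫_{ℝ^d} Z(x)·g(x) dμ(x). -/

import Mathlib

open MeasureTheory Filter Metric Set
open scoped ENNReal Topology RealInnerProductSpace

noncomputable section

/-- Points of `ℝ^d`, with the Euclidean norm. -/
abbrev Euc (d : ℕ) : Type := EuclideanSpace ℝ (Fin d)

/-- An admissible irrigation plan for the (positive, bounded, Radon) measure `μ` on `ℝ^d`: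
particles are parametrized by `θ ∈ [0, M]` where `M = μ(ℝ^d)`; each particle path
`t ↦ χ(θ,t)` is 1-Lipschitz, starts at the origin, has unit speed up to its stopping time
`T θ` and is constant afterwards; the push-forward of Lebesgue measure on `[0,M]` under
`θ ↦ χ(θ, T θ)` is `μ`. -/
structure IrrigationPlan {d : ℕ} (μ : Measure (Euc d)) where
  toFun : ℝ → ℝ → Euc d
  T : ℝ → ℝ
  measurable : Measurable (Function.uncurry toFun)
  T_nonneg : ∀ θ, 0 ≤ T θ
  lipschitz : ∀ θ ∈ Icc (0 : ℝ) (μ univ).toReal, LipschitzWith 1 (toFun θ)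
  unit_speed : ∀ θ ∈ Icc (0 : ℝ) (μ univ).toReal,
      ∀ᵐ t ∂(volume.restrict (Icc (0 : ℝ) (T θ))), ‖deriv (toFun θ) t‖ = 1
  stopped : ∀ θ ∈ Icc (0 : ℝ) (μ univ).toReal, ∀ t, T θ ≤ t → toFun θ t = toFun θ (T θ)
  start : ∀ θ ∈ Icc (0 : ℝ) (μ univ).toReal, toFun θ 0 = 0
  irrigates : Measure.map (fun θ => toFun θ (T θ))
      (volume.restrict (Icc (0 : ℝ) (μ univ).toReal)) = μ

/-- The multiplicity (total flux) `|x|_χ` of the plan `χ` at a point `x`. -/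
def IrrigationPlan.mult {d : ℕ} {μ : Measure (Euc d)} (χ : IrrigationPlan μ) (x : Euc d) : ℝ≥0∞ :=
  volume {θ : ℝ | θ ∈ Icc (0 : ℝ) (μ univ).toReal ∧ ∃ t, 0 ≤ t ∧ χ.toFun θ t = x}

/-- The total cost `E^α(χ)` of an irrigation plan `χ`. -/
def IrrigationPlan.cost {d : ℕ} {μ : Measure (Euc d)} (α : ℝ) (χ : IrrigationPlan μ) : ℝ≥0∞ :=
  ∫⁻ θ in Icc (0 : ℝ) (μ univ).toReal,
    ∫⁻ t in Ici (0 : ℝ),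
      χ.mult (χ.toFun θ t) ^ (α - 1) * ENNReal.ofReal ‖deriv (χ.toFun θ) t‖

/-- The α-irrigation cost `I^α(μ)` of the measure `μ` from the origin: the infimum of the
costs of all admissible plans (`+∞` if there is none). -/
def irrigationCost {d : ℕ} (α : ℝ) (μ : Measure (Euc d)) : ℝ≥0∞ :=
  ⨅ χ : IrrigationPlan μ, χ.cost α

/-- A plan is optimal if it attains the α-irrigation cost. -/
def IrrigationPlan.IsOptimal {d : ℕ} {μ : Measure (Euc d)} (α : ℝ) (χ : IrrigationPlan μ) : Prop :=
  χ.cost α = irrigationCost α μ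

/-- The value `Z_χ(x) = ∫_0^τ |χ(θ,t)|_χ^{α-1} dt`, where `χ(θ,τ) = x`; for plans with the
single path property this quantity is independent of the choice of `(θ,τ)`. -/
def IrrigationPlan.Zchi {d : ℕ} {μ : Measure (Euc d)} (α : ℝ) (χ : IrrigationPlan μ)
    (x : Euc d) : ℝ≥0∞ :=
  ⨅ (θ : ℝ) (_ : θ ∈ Icc (0 : ℝ) (μ univ).toReal) (τ : ℝ) (_ : 0 ≤ τ) (_ : χ.toFun θ τ = x),
    ∫⁻ t in Icc (0 : ℝ) τ, χ.mult (χ.toFun θ t) ^ (α - 1)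

/-- The landscape function: the lower semicontinuous envelope of `Z_χ` along
`Γ = {y : |y|_χ > 0}`, with value `+∞` outside the closure of `Γ`. -/
def IrrigationPlan.landscape {d : ℕ} {μ : Measure (Euc d)} (α : ℝ) (χ : IrrigationPlan μ)
    (x : Euc d) : ℝ≥0∞ :=
  Filter.liminf (χ.Zchi α) (𝓝[{y | 0 < χ.mult y}] x)

/-- unit speed 1-Lipschitz path stopped at time `T` -/
structure IsPath {d : ℕ} (c : ℝ → Euc d) (T : ℝ) : Prop where
  T0 : 0 ≤ T
  lip : LipschitzWith 1 c
  speed : ∀ᵐ t ∂(volume.restrict (Icc (0 : ℝ) T)), ‖deriv c t‖ = 1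
  halts : ∀ t, T ≤ t → c t = c T

/-- first hitting times -/
def firstSet {d : ℕ} (c : ℝ → Euc d) (T : ℝ) : Set ℝ :=
  {t | t ∈ Icc 0 T ∧ ∀ s, 0 ≤ s → s < t → c s ≠ c t}

lemma measurable_exists_zero {Ω X : Type*} [MeasurableSpace Ω] [TopologicalSpace X]
    [CompactSpace X] [TopologicalSpace.SeparableSpace X] (f : Ω → X → ℝ)
    (hm : ∀ x, Measurable fun ω => f ω x) (hc : ∀ ω, Continuous (f ω)) :
    MeasurableSet {ω | ∃ x, f ω x = 0} := by
  rcases isEmpty_or_nonempty X with hX | hX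
  · simp
  have : {ω | ∃ x, f ω x = 0} =
      ⋂ n : ℕ, ⋃ k : ℕ, {ω | |f ω (TopologicalSpace.denseSeq X k)| < 1 / ((n : ℝ) + 1)} := by
    ext ω
    simp only [mem_ofPred_eq, mem_iInter, mem_iUnion]
    constructor
    · rintro ⟨x, hx⟩ n
      have ho : IsOpen {y | |f ω y| < 1 / ((n : ℝ) + 1)} :=
        isOpen_lt (hc ω).abs continuous_const
      have hx' : x ∈ {y | |f ω y| < 1 / ((n : ℝ) + 1)} := by
        simp only [mem_ofPred_eq, hx, abs_zero]; positivity
      obtain ⟨k, hk⟩ := (TopologicalSpace.denseRange_denseSeq X).exists_mem_open ho ⟨x, hx'⟩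
      exact ⟨k, hk⟩
    · intro h
      obtain ⟨x, -, hx⟩ := isCompact_univ.exists_isMinOn (univ_nonempty (α := X))
        (hc ω).abs.continuousOn
      refine ⟨x, ?_⟩
      by_contra hne
      obtain ⟨n, hn⟩ := exists_nat_one_div_lt (abs_pos.2 hne)
      obtain ⟨k, hk⟩ := h n
      have := hx (mem_univ (TopologicalSpace.denseSeq X k))
      simp only [mem_ofPred_eq] at this
      linarith
  rw [this]
  refine MeasurableSet.iInter fun n => MeasurableSet.iUnion fun k => ?_
  exact measurableSet_lt ((hm _).abs) measurable_const

lemma measurable_mem_image {d : ℕ} {Ω : Type*} [MeasurableSpace Ω] {c : Ω → ℝ → Euc d}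
    (hc : Measurable (Function.uncurry c)) (hcc : ∀ ω, Continuous (c ω)) {S : Ω → ℝ}
    (hS : Measurable S) {y : Ω → Euc d} (hy : Measurable y) :
    MeasurableSet {ω | y ω ∈ c ω '' Icc 0 (S ω)} := by
  have h1 : MeasurableSet {ω | ∃ r : unitInterval, ‖c ω (S ω * r) - y ω‖ = 0} := by
    refine measurable_exists_zero _ (fun r => ?_) (fun ω => ?_)
    · exact ((hc.comp (measurable_id.prodMk (hS.mul_const _))).sub hy).norm
    · have := hcc ω
      fun_prop
  have h2 : MeasurableSet {ω | 0 ≤ S ω} := measurableSet_le measurable_const hS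
  convert h2.inter h1 using 1
  ext ω
  simp only [mem_ofPred_eq, mem_inter_iff, mem_image, mem_Icc, norm_eq_zero, sub_eq_zero]
  constructor
  · rintro ⟨t, ⟨h0, h1⟩, h⟩
    refine ⟨h0.trans h1, ?_⟩
    rcases (h0.trans h1).eq_or_lt with hz | hz
    · refine ⟨0, ?_⟩
      have : t = 0 := le_antisymm (h1.trans hz.ge) h0
      rw [← h, this]; simp
    · refine ⟨⟨t / S ω, by positivity, (div_le_one hz).2 h1⟩, ?_⟩
      simp only
      rw [mul_div_cancel₀ _ hz.ne', h]
  · rintro ⟨h0, r, hr⟩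
    refine ⟨S ω * r, ⟨mul_nonneg h0 r.2.1, mul_le_of_le_one_right h0 r.2.2⟩, hr⟩

lemma measurable_firstSet {d : ℕ} {Ω : Type*} [MeasurableSpace Ω] {c : Ω → ℝ → Euc d}
    (hc : Measurable (Function.uncurry c)) (hcc : ∀ ω, Continuous (c ω)) {T : Ω → ℝ}
    (hT : Measurable T) :
    MeasurableSet {q : Ω × ℝ | q.2 ∈ firstSet (c q.1) (T q.1)} := by
  have hc' : Measurable (Function.uncurry fun (q : Ω × ℝ) => c q.1) :=
    hc.comp ((measurable_fst.comp measurable_fst).prodMk measurable_snd)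
  have h1 : ∀ n : ℕ, MeasurableSet {q : Ω × ℝ | 0 < q.2 ∧
      c q.1 q.2 ∈ c q.1 '' Icc 0 ((1 - 1 / ((n : ℝ) + 1)) * q.2)} := fun n =>
    (measurableSet_lt measurable_const measurable_snd).inter
      (measurable_mem_image hc' (fun q => hcc q.1) (measurable_snd.const_mul _) hc)
  have h2 : MeasurableSet {q : Ω × ℝ | q.2 ∈ Icc 0 (T q.1)} :=
    (measurableSet_le measurable_const measurable_snd).inter
      (measurableSet_le measurable_snd (hT.comp measurable_fst))
  convert h2.diff (MeasurableSet.iUnion h1) using 1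
  ext ⟨ω, t⟩
  simp only [firstSet, mem_ofPred_eq, Set.mem_sdiff, mem_iUnion, not_exists]
  refine and_congr_right fun ht => ?_
  constructor
  · rintro h n ⟨hpos, s, ⟨hs0, hs1⟩, hs⟩
    refine h s hs0 (hs1.trans_lt ?_) hs
    have : (0 : ℝ) < 1 / ((n : ℝ) + 1) := by positivity
    nlinarith
  · intro h s hs0 hst hs
    have hpos := hs0.trans_lt hst
    obtain ⟨n, hn⟩ := exists_nat_one_div_lt (show 0 < 1 - s / t by
      rw [sub_pos, div_lt_one hpos]; exact hst)
    refine h n ⟨hpos, s, ⟨hs0, ?_⟩, hs⟩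
    rw [← div_le_iff₀ hpos]
    linarith

lemma IsPath.measurableSet_first {d : ℕ} {c : ℝ → Euc d} {T : ℝ} (h : IsPath c T) :
    MeasurableSet (firstSet c T) := by
  have := measurable_firstSet (Ω := Unit) (c := fun _ => c) (T := fun _ => T)
    (h.lip.continuous.measurable.comp measurable_snd) (fun _ => h.lip.continuous) measurable_const
  exact (measurable_const (a := ()).prodMk measurable_id) this

lemma firstSet_subset {d : ℕ} {c : ℝ → Euc d} {T : ℝ} : firstSet c T ⊆ Icc 0 T :=
  fun _ h => h.1

lemma firstSet_injOn {d : ℕ} {c : ℝ → Euc d} {T : ℝ} : InjOn c (firstSet c T) := by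
  intro s hs t ht h
  rcases lt_trichotomy s t with h1 | h1 | h1
  · exact absurd h (ht.2 s hs.1.1 h1)
  · exact h1
  · exact absurd h.symm (hs.2 t ht.1.1 h1)

/-- there is a first hitting time -/
lemma exists_first {d : ℕ} {c : ℝ → Euc d} {T : ℝ} (hc : Continuous c) {x : Euc d}
    (hx : x ∈ c '' Icc 0 T) : ∃ t ∈ firstSet c T, c t = x := by
  have hK : IsCompact (Icc 0 T ∩ c ⁻¹' {x}) :=
    isCompact_Icc.inter_right (isClosed_singleton.preimage hc)
  obtain ⟨t, ht, hmin⟩ := hK.exists_isLeast (by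
    obtain ⟨t, ht, h⟩ := hx; exact ⟨t, ht, h⟩)
  refine ⟨t, ⟨ht.1, fun s hs hst h => ?_⟩, ht.2⟩
  have := hmin ⟨⟨hs, hst.le.trans ht.1.2⟩, h.trans ht.2⟩
  linarith

lemma image_first {d : ℕ} {c : ℝ → Euc d} {T : ℝ} (hc : Continuous c) (B : Set (Euc d)) :
    c '' (firstSet c T ∩ c ⁻¹' B) = B ∩ c '' Icc 0 T := by
  ext x
  constructor
  · rintro ⟨t, ⟨ht, hB⟩, rfl⟩
    exact ⟨hB, t, ht.1, rfl⟩
  · rintro ⟨hB, hx⟩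
    obtain ⟨t, ht, rfl⟩ := exists_first hc hx
    exact ⟨t, ⟨ht, hB⟩, rfl⟩

lemma haus_image_le {d : ℕ} {c : ℝ → Euc d} (hc : LipschitzWith 1 c) (s : Set ℝ) :
    μH[1] (c '' s) ≤ volume s := by
  have := hc.hausdorffMeasure_image_le (d := 1) zero_le_one s
  simpa [hausdorffMeasure_real] using this

/-- lower bound on a piece -/
lemma le_haus_image {d : ℕ} {c : ℝ → Euc d} {K : NNReal} {s : Set ℝ}
    (h : ∀ x ∈ s, ∀ y ∈ s, edist x y ≤ K * edist (c x) (c y)) :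
    volume s ≤ K * μH[1] (c '' s) := by
  have ha : AntilipschitzWith K (s.domRestrict c) := fun x y => h x x.2 y y.2
  have h1 := ha.le_hausdorffMeasure_image (d := 1) zero_le_one univ
  have h2 := (isometry_subtype_coe (s := s)).hausdorffMeasure_image (d := 1)
    (Or.inl zero_le_one) univ
  rw [image_univ, Subtype.range_coe, hausdorffMeasure_real] at h2
  rw [image_univ, range_domRestrict, ← h2, ENNReal.rpow_one] at h1
  exact h1

lemma IsPath.haus_eq {d : ℕ} {c : ℝ → Euc d} {T : ℝ} (h : IsPath c T) {B : Set (Euc d)}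
    (hB : MeasurableSet B) :
    volume (firstSet c T ∩ c ⁻¹' B) = μH[1] (B ∩ c '' Icc 0 T) := by
  have hcc := h.lip.continuous
  rw [← image_first hcc]
  refine le_antisymm ?_ (haus_image_le h.lip _)
  -- good set
  set D : Set ℝ := {t | DifferentiableAt ℝ c t ∧ ‖deriv c t‖ = 1} with hD
  have hDm : MeasurableSet D :=
    (measurableSet_of_differentiableAt ℝ c).inter
      ((measurable_deriv c).norm (measurableSet_singleton 1))
  have hnull : volume (Icc 0 T \ D) = 0 := by
    have h1 : ∀ᵐ t ∂(volume.restrict (Icc (0:ℝ) T)), t ∈ D := by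
      filter_upwards [h.speed] with t h2
      refine ⟨?_, h2⟩
      by_contra h3
      rw [deriv_zero_of_not_differentiableAt h3] at h2
      simp at h2
    rw [ae_restrict_iff' measurableSet_Icc] at h1
    refine measure_mono_null ?_ h1
    intro t ht h3
    exact ht.2 (h3 ht.1)
  set G := firstSet c T ∩ c ⁻¹' B ∩ D with hG
  have hGm : MeasurableSet G :=
    (h.measurableSet_first.inter (hcc.measurable hB)).inter hDm
  have hG1 : volume (firstSet c T ∩ c ⁻¹' B) ≤ volume G := by
    calc volume (firstSet c T ∩ c ⁻¹' B) ≤ volume (G ∪ (Icc 0 T \ D)) := by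
          apply measure_mono
          intro t ht
          by_cases h1 : t ∈ D
          · exact Or.inl ⟨ht, h1⟩
          · exact Or.inr ⟨ht.1.1, h1⟩
      _ ≤ volume G + volume (Icc 0 T \ D) := measure_union_le _ _
      _ = volume G := by rw [hnull, add_zero]
  have hG2 : μH[1] (c '' G) ≤ μH[1] (c '' (firstSet c T ∩ c ⁻¹' B)) :=
    measure_mono (image_mono inter_subset_left)
  refine hG1.trans (le_trans ?_ hG2)
  have hinj : InjOn c G := firstSet_injOn.mono (fun t ht => ht.1.1)
  -- it suffices to prove with a constant
  have key : ∀ K : NNReal, 1 < K → volume G ≤ K * μH[1] (c '' G) := by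
    intro K hK
    have hK0 : (0 : ℝ) < K := by
      have : (1 : ℝ) < K := by exact_mod_cast hK
      linarith
    have hr : (0 : ℝ) < 1 - (K : ℝ)⁻¹ := by
      have : (1 : ℝ) < K := by exact_mod_cast hK
      rw [sub_pos]; exact inv_lt_one_of_one_lt₀ this
    set r : NNReal := ⟨1 - (K : ℝ)⁻¹, hr.le⟩ with hrd
    obtain ⟨t, A, tdisj, tm, tcov, tap, tA⟩ :=
      exists_partition_approximatesLinearOn_of_hasFDerivWithinAt c G
      (fun x => fderiv ℝ c x) (fun x hx => hx.2.1.hasFDerivAt.hasFDerivWithinAt)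
      (fun _ => r) (fun _ => by
        intro h0
        have : (1 - (K : ℝ)⁻¹) = 0 := congrArg NNReal.toReal h0
        linarith)
    rcases G.eq_empty_or_nonempty with hem | hne
    · rw [hem]; simp
    have piece : ∀ n, volume (G ∩ t n) ≤ K * μH[1] (c '' (G ∩ t n)) := by
      intro n
      apply le_haus_image
      intro x hx y hy
      have h1 := tap n x hx y hy
      obtain ⟨z, hz, hAz⟩ := tA hne n
      have h2 : ‖(A n) (x - y)‖ = |x - y| := by
        rw [hAz]
        have : (fderiv ℝ c z) (x - y) = (x - y) • deriv c z := by
          rw [← fderiv_apply_one_eq_deriv, ← map_smul]; simp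
        rw [this, norm_smul, hz.2.2]; simp
      have h3 : |x - y| ≤ K * ‖c x - c y‖ := by
        have h4 : ‖(A n) (x - y)‖ ≤ ‖c x - c y‖ + ‖c x - c y - (A n) (x - y)‖ := by
          have := norm_sub_le (c x - c y) (c x - c y - (A n) (x - y))
          simpa using this
        have h5 : ‖c x - c y - (A n) (x - y)‖ ≤ (1 - (K : ℝ)⁻¹) * |x - y| := h1
        have h6 : (K : ℝ)⁻¹ * |x - y| ≤ ‖c x - c y‖ := by nlinarith
        rwa [inv_mul_le_iff₀ hK0] at h6
      rw [edist_dist, edist_dist, Real.dist_eq, dist_eq_norm,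
        ← ENNReal.ofReal_coe_nnreal, ← ENNReal.ofReal_mul hK0.le]
      exact ENNReal.ofReal_le_ofReal h3
    have hGu : G = ⋃ n, G ∩ t n := by
      rw [← inter_iUnion]; exact (inter_eq_left.2 tcov).symm
    have hcu : c '' G = ⋃ n, c '' (G ∩ t n) := by
      rw [← image_iUnion, ← hGu]
    have hcm : ∀ n, MeasurableSet (c '' (G ∩ t n)) := fun n =>
      (hGm.inter (tm n)).image_of_continuousOn_injOn hcc.continuousOn
        (hinj.mono inter_subset_left)
    have hcd : Pairwise (Function.onFun Disjoint fun n => c '' (G ∩ t n)) := by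
      intro i j hij
      rw [Function.onFun, disjoint_left]
      rintro x ⟨a, ha, rfl⟩ ⟨b, hb, hab⟩
      have := hinj hb.1 ha.1 hab
      subst this
      exact disjoint_left.1 (tdisj hij) ha.2 hb.2
    calc volume G = volume (⋃ n, G ∩ t n) := by rw [← hGu]
      _ ≤ ∑' n, volume (G ∩ t n) := measure_iUnion_le _
      _ ≤ ∑' n, K * μH[1] (c '' (G ∩ t n)) := ENNReal.tsum_le_tsum piece
      _ = K * ∑' n, μH[1] (c '' (G ∩ t n)) := ENNReal.tsum_mul_left
      _ = K * μH[1] (c '' G) := by rw [hcu, measure_iUnion hcd hcm]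
  have hfin : μH[1] (c '' G) ≠ ⊤ := by
    refine ne_top_of_le_ne_top ?_ (haus_image_le h.lip G)
    refine ne_top_of_le_ne_top ?_ (measure_mono (t := Icc 0 T) fun t ht => ht.1.1.1)
    simp
  refine ENNReal.le_of_forall_pos_le_add fun ε hε _ => ?_
  set b := (μH[1] (c '' G)).toNNReal with hb
  have hb' : μH[1] (c '' G) = b := (ENNReal.coe_toNNReal hfin).symm
  have h1 := key (1 + ε / (b + 1)) (by
    have : 0 < ε / (b + 1) := by positivity
    exact lt_add_of_pos_right 1 this)
  rw [hb'] at h1 ⊢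
  refine h1.trans ?_
  norm_cast
  have : ε / (b + 1) * b ≤ ε := by
    rw [div_mul_eq_mul_div, div_le_iff₀ (by positivity)]
    gcongr
    exact le_self_add
  rw [add_mul, one_mul]
  gcongr

lemma IsPath.map_eq {d : ℕ} {c : ℝ → Euc d} {T : ℝ} (h : IsPath c T) :
    (volume.restrict (firstSet c T)).map c = μH[1].restrict (c '' Icc 0 T) := by
  ext B hB
  rw [Measure.map_apply h.lip.continuous.measurable hB, Measure.restrict_apply hB,
    Measure.restrict_apply (h.lip.continuous.measurable hB), ← h.haus_eq hB, inter_comm]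

lemma IsPath.lintegral_im {d : ℕ} {c : ℝ → Euc d} {T : ℝ} (h : IsPath c T)
    {φ : Euc d → ℝ≥0∞} (hφ : Measurable φ) :
    ∫⁻ x in c '' Icc 0 T, φ x ∂μH[1] = ∫⁻ t in firstSet c T, φ (c t) := by
  rw [← h.map_eq, lintegral_map hφ h.lip.continuous.measurable]

lemma IsPath.finite_im {d : ℕ} {c : ℝ → Euc d} {T : ℝ} (h : IsPath c T) :
    IsFiniteMeasure (μH[1].restrict (c '' Icc 0 T) : Measure (Euc d)) := by
  constructor
  rw [Measure.restrict_apply_univ]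
  refine (haus_image_le h.lip _).trans_lt ?_
  simp

lemma measurableSet_im {d : ℕ} {c : ℝ → Euc d} {T : ℝ} (h : Continuous c) :
    MeasurableSet (c '' Icc 0 T) :=
  (isCompact_Icc.image h).measurableSet

/-- for any piece of a Lipschitz path -/
lemma lintegral_image_le {d : ℕ} {c : ℝ → Euc d} (h : LipschitzWith 1 c) {s : Set ℝ}
    {φ : Euc d → ℝ≥0∞} (hφ : Measurable φ) :
    ∫⁻ x in c '' s, φ x ∂μH[1] ≤ ∫⁻ t in s, φ (c t) := by
  have hc := h.continuous.measurable
  rw [← lintegral_map hφ hc]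
  refine lintegral_mono' ?_ le_rfl
  rw [Measure.le_iff]
  intro B hB
  rw [Measure.restrict_apply hB, Measure.map_apply hc hB, Measure.restrict_apply (hc hB)]
  refine le_trans (measure_mono ?_) (haus_image_le h _)
  rintro x ⟨hx, t, ht, rfl⟩
  exact ⟨t, ⟨hx, ht⟩, rfl⟩

/-- measurable family of paths -/
structure Fam (Ω : Type*) [MeasurableSpace Ω] (d : ℕ) where
  γ : Ω → ℝ → Euc d
  T : Ω → ℝ
  meas : Measurable (Function.uncurry γ)
  measT : Measurable T
  path : ∀ ω, IsPath (γ ω) (T ω)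

namespace Fam

variable {Ω Ω' : Type*} [MeasurableSpace Ω] [MeasurableSpace Ω'] {d : ℕ}

/-- image of the path `ω` -/
def im (f : Fam Ω d) (ω : Ω) : Set (Euc d) := f.γ ω '' Icc 0 (f.T ω)

/-- multiplicity -/
def mult (f : Fam Ω d) (P : Measure Ω) (x : Euc d) : ℝ≥0∞ := P {ω | x ∈ f.im ω}

/-- first hitting set -/
def first (f : Fam Ω d) : Set (Ω × ℝ) := {q | q.2 ∈ firstSet (f.γ q.1) (f.T q.1)}

/-- occupation measure -/
def occ (f : Fam Ω d) (P : Measure Ω) : Measure (Euc d) :=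
  ((P.prod volume).restrict f.first).map (Function.uncurry f.γ)

lemma cont (f : Fam Ω d) (ω : Ω) : Continuous (f.γ ω) := (f.path ω).lip.continuous

lemma measurable_first (f : Fam Ω d) : MeasurableSet f.first :=
  measurable_firstSet f.meas f.cont f.measT

lemma measurable_im (f : Fam Ω d) : MeasurableSet {q : Ω × Euc d | q.2 ∈ f.im q.1} := by
  have h : Measurable (Function.uncurry fun (q : Ω × Euc d) => f.γ q.1) :=
    f.meas.comp ((measurable_fst.comp measurable_fst).prodMk measurable_snd)
  exact measurable_mem_image h (fun q => f.cont q.1) (f.measT.comp measurable_fst) measurable_snd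

lemma measurableSet_im' (f : Fam Ω d) (ω : Ω) : MeasurableSet (f.im ω) :=
  measurableSet_im (f.cont ω)

lemma measurable_thru (f : Fam Ω d) (x : Euc d) : MeasurableSet {ω | x ∈ f.im ω} :=
  (measurable_id.prodMk measurable_const : Measurable fun ω : Ω => (ω, x)) f.measurable_im

lemma measurable_mult (f : Fam Ω d) (P : Measure Ω) [SFinite P] : Measurable (f.mult P) := by
  have := measurable_measure_prodMk_right (μ := P) f.measurable_im
  exact this

lemma mult_ne_top (f : Fam Ω d) (P : Measure Ω) [IsFiniteMeasure P] (x : Euc d) :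
    f.mult P x ≠ ⊤ := measure_ne_top _ _

/-- measurability of integrals along paths -/
lemma measurable_path_integral {Y : Type*} [MeasurableSpace Y] (f : Fam Ω d)
    {φ : Y → Ω → Euc d → ℝ≥0∞}
    (hφ : Measurable fun q : Y × Ω × Euc d => φ q.1 q.2.1 q.2.2) :
    Measurable fun q : Y × Ω => ∫⁻ x in f.im q.2, φ q.1 q.2 x ∂μH[1] := by
  have h1 : ∀ q : Y × Ω, ∫⁻ x in f.im q.2, φ q.1 q.2 x ∂μH[1] =
      ∫⁻ t, f.first.indicator (fun r : Ω × ℝ => φ q.1 r.1 (f.γ r.1 r.2)) (q.2, t) := by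
    intro q
    have hm : Measurable (φ q.1 q.2) :=
      hφ.comp (measurable_const.prodMk (measurable_const.prodMk measurable_id))
    rw [im, (f.path q.2).lintegral_im hm, ← lintegral_indicator (f.path q.2).measurableSet_first]
    rfl
  simp_rw [h1]
  refine Measurable.lintegral_prod_right' (f := fun (p : (Y × Ω) × ℝ) =>
    f.first.indicator (fun r : Ω × ℝ => φ p.1.1 r.1 (f.γ r.1 r.2)) (p.1.2, p.2)) ?_
  have : (fun (p : (Y × Ω) × ℝ) =>
    f.first.indicator (fun r : Ω × ℝ => φ p.1.1 r.1 (f.γ r.1 r.2)) (p.1.2, p.2)) =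
    ((fun p : (Y × Ω) × ℝ => (p.1.2, p.2)) ⁻¹' f.first).indicator
      (fun p => φ p.1.1 p.1.2 (f.γ p.1.2 p.2)) := by
    ext p; rfl
  rw [this]
  have hp : Measurable (fun p : (Y × Ω) × ℝ => (p.1.2, p.2)) := by fun_prop
  refine Measurable.indicator ?_ (hp f.measurable_first)
  exact hφ.comp ((measurable_fst.comp measurable_fst).prodMk
    ((measurable_snd.comp measurable_fst).prodMk (f.meas.comp hp)))

lemma lintegral_occ (f : Fam Ω d) (P : Measure Ω) [SFinite P] {φ : Euc d → ℝ≥0∞}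
    (hφ : Measurable φ) :
    ∫⁻ x, φ x ∂(f.occ P) = ∫⁻ ω, ∫⁻ x in f.im ω, φ x ∂μH[1] ∂P := by
  rw [occ, lintegral_map hφ f.meas, ← lintegral_indicator f.measurable_first, lintegral_prod]
  · refine lintegral_congr fun ω => ?_
    rw [im, (f.path ω).lintegral_im hφ, ← lintegral_indicator (f.path ω).measurableSet_first]
    rfl
  · exact ((hφ.comp f.meas).indicator f.measurable_first).aemeasurable

lemma swap_aux {Ω₁ Ω₂ : Type*} [MeasurableSpace Ω₁] [MeasurableSpace Ω₂]
    (f₁ : Fam Ω₁ d) (f₂ : Fam Ω₂ d)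
    (P₂ : Measure Ω₂) [SFinite P₂] (ψ : Ω₂ → Euc d → ℝ≥0∞)
    (hψ : Measurable fun q : Ω₂ × Euc d => ψ q.1 q.2) (ω : Ω₁) :
      ∫⁻ x in f₁.im ω, ∫⁻ ω' in {ω' | x ∈ f₂.im ω'}, ψ ω' x ∂P₂ ∂μH[1] =
      ∫⁻ ω', ∫⁻ x in f₁.im ω ∩ f₂.im ω', ψ ω' x ∂μH[1] ∂P₂ := by
  have := (f₁.path ω).finite_im
  have : IsFiniteMeasure (μH[1].restrict (f₁.im ω)) := this
  have h1 : ∀ x, ∫⁻ ω' in {ω' | x ∈ f₂.im ω'}, ψ ω' x ∂P₂ =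
      ∫⁻ ω', {q : Ω₂ × Euc d | q.2 ∈ f₂.im q.1}.indicator (fun q => ψ q.1 q.2) (ω', x) ∂P₂ := by
    intro x
    rw [← lintegral_indicator (f₂.measurable_thru x)]
    rfl
  simp_rw [h1]
  rw [lintegral_lintegral_swap]
  · refine lintegral_congr fun ω' => ?_
    rw [inter_comm, ← Measure.restrict_restrict (f₂.measurableSet_im' ω'),
      ← lintegral_indicator (f₂.measurableSet_im' ω')]
    rfl
  · exact ((hψ.indicator f₂.measurable_im).comp measurable_swap).aemeasurable

lemma swap_general (f : Fam Ω d) (f' : Fam Ω' d) (P : Measure Ω) [SFinite P]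
    (P' : Measure Ω') [SFinite P'] {φ : Ω → Ω' → Euc d → ℝ≥0∞}
    (hφ : Measurable fun q : Ω × Ω' × Euc d => φ q.1 q.2.1 q.2.2) :
    ∫⁻ ω, ∫⁻ x in f.im ω, ∫⁻ ω' in {ω' | x ∈ f'.im ω'}, φ ω ω' x ∂P' ∂μH[1] ∂P =
    ∫⁻ ω', ∫⁻ x in f'.im ω', ∫⁻ ω in {ω | x ∈ f.im ω}, φ ω ω' x ∂P ∂μH[1] ∂P' := by
  have hA : ∀ ω, ∫⁻ x in f.im ω, ∫⁻ ω' in {ω' | x ∈ f'.im ω'}, φ ω ω' x ∂P' ∂μH[1] =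
      ∫⁻ ω', ∫⁻ x in f.im ω ∩ f'.im ω', φ ω ω' x ∂μH[1] ∂P' := fun ω =>
    swap_aux f f' P' (φ ω) (hφ.comp (measurable_const.prodMk measurable_id)) ω
  have hB : ∀ ω', ∫⁻ x in f'.im ω', ∫⁻ ω in {ω | x ∈ f.im ω}, φ ω ω' x ∂P ∂μH[1] =
      ∫⁻ ω, ∫⁻ x in f.im ω ∩ f'.im ω', φ ω ω' x ∂μH[1] ∂P := fun ω' => by
    rw [swap_aux f' f P (fun ω => φ ω ω') (hφ.comp (measurable_fst.prodMk
      (measurable_const.prodMk measurable_snd))) ω']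
    simp_rw [inter_comm]
  simp_rw [hA, hB]
  rw [lintegral_lintegral_swap]
  have h2 : (Function.uncurry fun ω ω' => ∫⁻ x in f.im ω ∩ f'.im ω', φ ω ω' x ∂μH[1]) =
      fun q : Ω × Ω' => ∫⁻ x in f'.im q.2,
        {p : Ω × Euc d | p.2 ∈ f.im p.1}.indicator (fun p => φ p.1 q.2 p.2) (q.1, x) ∂μH[1] := by
    ext ⟨ω, ω'⟩
    simp only [Function.uncurry]
    rw [← Measure.restrict_restrict (f.measurableSet_im' ω),
        ← lintegral_indicator (f.measurableSet_im' ω)]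
    rfl
  rw [h2]
  refine (f'.measurable_path_integral (Y := Ω) (φ := fun ω ω' x =>
    {p : Ω × Euc d | p.2 ∈ f.im p.1}.indicator (fun p => φ p.1 ω' p.2) (ω, x)) ?_).aemeasurable
  have h3 : (fun q : Ω × Ω' × Euc d => {p : Ω × Euc d | p.2 ∈ f.im p.1}.indicator
      (fun p => φ p.1 q.2.1 p.2) (q.1, q.2.2)) =
      ((fun q : Ω × Ω' × Euc d => (q.1, q.2.2)) ⁻¹' {p : Ω × Euc d | p.2 ∈ f.im p.1}).indicator
        (fun q => φ q.1 q.2.1 q.2.2) := by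
    ext q; rfl
  rw [h3]
  refine hφ.indicator ?_
  have : Measurable (fun q : Ω × Ω' × Euc d => (q.1, q.2.2)) := by fun_prop
  exact this f.measurable_im

lemma compat (f : Fam Ω d) (f' : Fam Ω' d) (P : Measure Ω) [SFinite P]
    (P' : Measure Ω') [SFinite P'] :
    (f.occ P).withDensity (f'.mult P') = (f'.occ P').withDensity (f.mult P) := by
  ext B hB
  rw [withDensity_apply _ hB, withDensity_apply _ hB, ← lintegral_indicator hB,
    ← lintegral_indicator hB, lintegral_occ _ _ ((f'.measurable_mult P').indicator hB),
    lintegral_occ _ _ ((f.measurable_mult P).indicator hB)]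
  have hφ : Measurable fun q : Ω × Ω' × Euc d => B.indicator (fun _ => (1 : ℝ≥0∞)) q.2.2 :=
    (measurable_const.indicator hB).comp (measurable_snd.comp measurable_snd)
  have := swap_general f f' P P' (φ := fun _ _ x => B.indicator (fun _ => (1 : ℝ≥0∞)) x) hφ
  simp only [lintegral_const, Measure.restrict_apply_univ] at this
  have e : ∀ (h : Euc d → ℝ≥0∞) (x : Euc d),
      B.indicator h x = B.indicator (fun _ => (1 : ℝ≥0∞)) x * h x := by
    intro h x
    by_cases hx : x ∈ B <;> simp [hx]
  simp_rw [e (f'.mult P'), e (f.mult P)]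
  exact this

/-- the set-based cost -/
def F (f : Fam Ω d) (P : Measure Ω) (α : ℝ) : ℝ≥0∞ :=
  ∫⁻ x, f.mult P x ^ (α - 1) ∂(f.occ P)

end Fam

lemma tangent_ineq {α : ℝ} (hα : α ∈ Ioo (0 : ℝ) 1) {a b : ℝ≥0∞} (ha : a ≠ ⊤) (hb : b ≠ ⊤) :
    b ^ (α - 1) * (b * a⁻¹) ≤ ENNReal.ofReal (1 - α) * a ^ (α - 1) +
      ENNReal.ofReal α * (a ^ (α - 1) * (b * a⁻¹)) := by
  have h1α : (0 : ℝ) < 1 - α := by linarith [hα.2]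
  have hα1 : α - 1 < 0 := by linarith [hα.2]
  rcases eq_or_ne a 0 with rfl | ha0
  · rw [ENNReal.zero_rpow_of_neg hα1, ENNReal.mul_top (by simpa using h1α)]
    simp
  rcases eq_or_ne b 0 with rfl | hb0
  · simp
  lift a to NNReal using ha
  lift b to NNReal using hb
  have ha0' : a ≠ 0 := by simpa using ha0
  have hb0' : b ≠ 0 := by simpa using hb0
  have hap : (0 : ℝ) < a := by positivity
  have hbp : (0 : ℝ) < b := by positivity
  rw [← ENNReal.coe_rpow_of_ne_zero ha0', ← ENNReal.coe_rpow_of_ne_zero hb0',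
    ← ENNReal.coe_inv ha0', ENNReal.ofReal, ENNReal.ofReal]
  norm_cast
  rw [← NNReal.coe_le_coe]
  push_cast
  rw [Real.coe_toNNReal _ h1α.le, Real.coe_toNNReal _ hα.1.le]
  set r : ℝ := b * (a : ℝ)⁻¹ with hr
  have hrp : 0 < r := by positivity
  have hb : (b : ℝ) = r * a := by rw [hr]; field_simp
  have h2 : (b : ℝ) ^ (α - 1) * r = (a : ℝ) ^ (α - 1) * r ^ α := by
    rw [hb, Real.mul_rpow hrp.le hap.le, mul_comm (r ^ (α - 1)), mul_assoc]
    congr 1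
    rw [← Real.rpow_add_one hrp.ne']; congr 1; ring
  rw [h2]
  have h3 : r ^ α ≤ (1 - α) + α * r := by
    have := Real.geom_mean_le_arith_mean2_weighted h1α.le hα.1.le zero_le_one hrp.le (by ring)
    simpa using this
  have h4 : (0 : ℝ) < (a : ℝ) ^ (α - 1) := by positivity
  nlinarith

/-- concavity comparison -/
lemma concave_compare {d : ℕ} {α : ℝ} (hα : α ∈ Ioo (0 : ℝ) 1) {π₁ π₂ : Measure (Euc d)}
    {m₁ m₂ : Euc d → ℝ≥0∞} (hm₁ : Measurable m₁) (hm₂ : Measurable m₂)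
    (h₁ : ∀ x, m₁ x ≠ ⊤) (h₂ : ∀ x, m₂ x ≠ ⊤)
    (hc : π₁.withDensity m₂ = π₂.withDensity m₁) :
    ∫⁻ x, m₂ x ^ (α - 1) ∂π₂ ≤ ENNReal.ofReal (1 - α) * ∫⁻ x, m₁ x ^ (α - 1) ∂π₁ +
      ENNReal.ofReal α * ∫⁻ x, m₁ x ^ (α - 1) ∂π₂ := by
  have hα1 : α - 1 < 0 := by linarith [hα.2]
  by_cases htop : ∫⁻ x, m₁ x ^ (α - 1) ∂π₂ = ⊤
  · rw [htop, ENNReal.mul_top (by simpa using hα.1)]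
    simp
  have hne : ∀ᵐ x ∂π₂, m₁ x ≠ 0 := by
    filter_upwards [ae_lt_top (hm₁.pow_const _) htop] with x hx h0
    rw [h0, ENNReal.zero_rpow_of_neg hα1] at hx
    exact lt_irrefl _ hx
  have key : ∀ φ : Euc d → ℝ≥0∞, Measurable φ →
      ∫⁻ x, φ x ∂π₂ = ∫⁻ x, φ x * (m₂ x * (m₁ x)⁻¹) ∂π₁ := by
    intro φ hφ
    have hq : Measurable (fun x => φ x * (m₁ x)⁻¹) := hφ.mul hm₁.inv
    have e1 : ∫⁻ x, φ x ∂π₂ = ∫⁻ x, φ x * (m₁ x)⁻¹ ∂(π₂.withDensity m₁) := by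
      rw [lintegral_withDensity_eq_lintegral_mul _ hm₁ hq]
      refine lintegral_congr_ae ?_
      filter_upwards [hne] with x hx
      simp only [Pi.mul_apply]
      rw [mul_comm, mul_assoc, ENNReal.inv_mul_cancel hx (h₁ x), mul_one]
    rw [e1, ← hc, lintegral_withDensity_eq_lintegral_mul _ hm₂ hq]
    refine lintegral_congr fun x => ?_
    simp only [Pi.mul_apply]
    ring
  have hq2 : Measurable (fun x => m₁ x ^ (α - 1) * (m₂ x * (m₁ x)⁻¹)) :=
    (hm₁.pow_const _).mul (hm₂.mul hm₁.inv)
  rw [key _ (hm₂.pow_const _), key _ (hm₁.pow_const _), ← lintegral_const_mul _ (hm₁.pow_const _),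
    ← lintegral_const_mul _ hq2,
    ← lintegral_add_left ((hm₁.pow_const _).const_mul _)]
  exact lintegral_mono fun x => tangent_ineq hα (h₁ x) (h₂ x)

section LoopErase
variable {d : ℕ}

/-- longest loop -/
def loopLen (c : ℝ → Euc d) (T : ℝ) : ℝ :=
  sSup {l | l ∈ Icc 0 T ∧ ∃ s ∈ Icc 0 (T - l), c s = c (s + l)}

/-- start of the longest loop -/
def loopStart (c : ℝ → Euc d) (T : ℝ) : ℝ :=
  sInf {s | s ∈ Icc 0 (T - loopLen c T) ∧ c s = c (s + loopLen c T)}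

lemma loopLen_mem {c : ℝ → Euc d} {T : ℝ} (hc : Continuous c) (hT : 0 ≤ T) :
    loopLen c T ∈ {l | l ∈ Icc 0 T ∧ ∃ s ∈ Icc 0 (T - l), c s = c (s + l)} := by
  refine IsCompact.sSup_mem ?_ ⟨0, ⟨le_rfl, hT⟩, 0, ⟨le_rfl, by linarith⟩, by simp⟩
  have hK : IsCompact ((Icc 0 T ×ˢ Icc 0 T) ∩ {p : ℝ × ℝ | p.2 + p.1 ≤ T ∧ c p.2 = c (p.2 + p.1)}) := by
    refine (isCompact_Icc.prod isCompact_Icc).inter_right ?_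
    have i1 : IsClosed {p : ℝ × ℝ | p.2 + p.1 ≤ T} := isClosed_le (by fun_prop) (by fun_prop)
    have i2 : IsClosed {p : ℝ × ℝ | c p.2 = c (p.2 + p.1)} :=
      isClosed_eq (by fun_prop) (by fun_prop)
    exact i1.inter i2
  convert hK.image continuous_fst using 1
  ext l
  constructor
  · rintro ⟨hl, s, hs, h⟩
    exact ⟨(l, s), ⟨⟨hl, hs.1, by linarith [hs.2, hl.1]⟩, by simp; linarith [hs.2], h⟩, rfl⟩
  · rintro ⟨⟨l', s⟩, ⟨⟨hl, hs⟩, h1, h2⟩, rfl⟩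
    exact ⟨hl, s, ⟨hs.1, by simp at h1 ⊢; linarith⟩, h2⟩

lemma loopStart_mem {c : ℝ → Euc d} {T : ℝ} (hc : Continuous c) (hT : 0 ≤ T) :
    loopStart c T ∈ {s | s ∈ Icc 0 (T - loopLen c T) ∧ c s = c (s + loopLen c T)} := by
  refine IsCompact.sInf_mem ?_ ?_
  · exact isCompact_Icc.inter_right (isClosed_eq (by fun_prop) (by fun_prop))
  · obtain ⟨_, s, hs, h⟩ := loopLen_mem hc hT
    exact ⟨s, hs, h⟩

lemma le_loopLen {c : ℝ → Euc d} {T : ℝ} {a b : ℝ} (ha : 0 ≤ a) (hab : a ≤ b) (hb : b ≤ T)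
    (h : c a = c b) : b - a ≤ loopLen c T := by
  refine le_csSup ⟨T, fun l hl => hl.1.2⟩ ⟨⟨by linarith, by linarith⟩, a, ⟨ha, by linarith⟩, ?_⟩
  rw [h]; congr 1; ring

lemma measurable_loopLen {Ω : Type*} [MeasurableSpace Ω] {c : Ω → ℝ → Euc d}
    (hc : Measurable (Function.uncurry c)) (hcc : ∀ ω, Continuous (c ω)) {T : Ω → ℝ}
    (hT : Measurable T) (hT0 : ∀ ω, 0 ≤ T ω) : Measurable fun ω => loopLen (c ω) (T ω) := by
  refine measurable_of_Ici fun a => ?_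
  rcases le_or_gt a 0 with ha | ha
  · convert MeasurableSet.univ
    ext ω
    simp only [mem_preimage, mem_Ici, mem_univ, iff_true]
    exact ha.trans (loopLen_mem (hcc ω) (hT0 ω)).1.1
  · have h1 : MeasurableSet {ω | ∃ r : unitInterval × unitInterval,
        ‖c ω ((T ω - (a + (T ω - a) * r.1)) * r.2) -
          c ω ((T ω - (a + (T ω - a) * r.1)) * r.2 + (a + (T ω - a) * r.1))‖ = 0} := by
      refine measurable_exists_zero _ (fun r => ?_) (fun ω => ?_)
      · refine ((hc.comp (measurable_id.prodMk ?_)).sub (hc.comp (measurable_id.prodMk ?_))).norm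
        · fun_prop
        · fun_prop
      · have := hcc ω
        fun_prop
    convert (measurableSet_le measurable_const hT : MeasurableSet {ω | a ≤ T ω}).inter h1
    ext ω
    simp only [mem_preimage, mem_Ici, mem_inter_iff, mem_ofPred_eq]
    constructor
    · intro h
      obtain ⟨⟨h1, h2⟩, s, ⟨h3, h4⟩, h5⟩ := loopLen_mem (hcc ω) (hT0 ω)
      set l := loopLen (c ω) (T ω)
      refine ⟨h.trans h2, ⟨⟨(l - a) / (T ω - a), ?_⟩, ⟨s / (T ω - l), ?_⟩⟩, ?_⟩
      · exact ⟨div_nonneg (by linarith) (by linarith), div_le_one_of_le₀ (by linarith) (by linarith)⟩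
      · exact ⟨div_nonneg (by linarith) (by linarith), div_le_one_of_le₀ (by linarith) (by linarith)⟩
      · have e1 : a + (T ω - a) * ((l - a) / (T ω - a)) = l := by
          rcases eq_or_ne (T ω - a) 0 with h0 | h0
          · rw [h0]; linarith
          · field_simp; ring
        have e2 : (T ω - l) * (s / (T ω - l)) = s := by
          rcases eq_or_ne (T ω - l) 0 with h0 | h0
          · rw [h0]; linarith
          · field_simp
        simp only [e1, e2, h5, sub_self, norm_zero]
    · rintro ⟨h, ⟨r1, r2⟩, h2⟩
      rw [norm_eq_zero, sub_eq_zero] at h2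
      simp only at h2
      set l := a + (T ω - a) * (r1 : ℝ)
      have hr1 := r1.2
      have hr2 := r2.2
      have hl1 : a ≤ l := by
        have : 0 ≤ (T ω - a) * (r1 : ℝ) := mul_nonneg (by linarith) hr1.1
        linarith
      have hl2 : l ≤ T ω := by
        have : (T ω - a) * (r1 : ℝ) ≤ (T ω - a) * 1 := mul_le_mul_of_nonneg_left hr1.2 (by linarith)
        linarith
      have hs1 : 0 ≤ (T ω - l) * (r2 : ℝ) := mul_nonneg (by linarith) hr2.1
      have hs2 : (T ω - l) * (r2 : ℝ) ≤ (T ω - l) * 1 :=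
        mul_le_mul_of_nonneg_left hr2.2 (by linarith)
      have := le_loopLen (c := c ω) (T := T ω) hs1 (by linarith) (by linarith) h2
      linarith

lemma measurable_loopStart {Ω : Type*} [MeasurableSpace Ω] {c : Ω → ℝ → Euc d}
    (hc : Measurable (Function.uncurry c)) (hcc : ∀ ω, Continuous (c ω)) {T : Ω → ℝ}
    (hT : Measurable T) (hT0 : ∀ ω, 0 ≤ T ω) : Measurable fun ω => loopStart (c ω) (T ω) := by
  have hL := measurable_loopLen hc hcc hT hT0
  refine measurable_of_Iic fun a => ?_
  rcases lt_or_ge a 0 with ha | ha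
  · convert MeasurableSet.empty
    ext ω
    simp only [mem_preimage, mem_Iic, mem_empty_iff_false, iff_false, not_le]
    exact ha.trans_le (loopStart_mem (hcc ω) (hT0 ω)).1.1
  · have h1 : MeasurableSet {ω | ∃ r : unitInterval,
        ‖c ω ((min a (T ω - loopLen (c ω) (T ω))) * r) -
          c ω ((min a (T ω - loopLen (c ω) (T ω))) * r + loopLen (c ω) (T ω))‖ = 0} := by
      refine measurable_exists_zero _ (fun r => ?_) (fun ω => ?_)
      · refine ((hc.comp (measurable_id.prodMk ?_)).sub (hc.comp (measurable_id.prodMk ?_))).norm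
        · fun_prop
        · fun_prop
      · have := hcc ω
        fun_prop
    convert h1
    ext ω
    simp only [mem_preimage, mem_Iic, mem_ofPred_eq]
    have hl := loopLen_mem (hcc ω) (hT0 ω)
    set l := loopLen (c ω) (T ω) with hldef
    have hm : 0 ≤ min a (T ω - l) := le_min ha (by linarith [hl.1.2])
    constructor
    · intro h
      obtain ⟨⟨h1, h2⟩, h3⟩ := loopStart_mem (hcc ω) (hT0 ω)
      set s := loopStart (c ω) (T ω)
      have hsm : s ≤ min a (T ω - l) := le_min h h2
      refine ⟨⟨s / min a (T ω - l), div_nonneg h1 hm, div_le_one_of_le₀ hsm hm⟩, ?_⟩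
      have e2 : min a (T ω - l) * (s / min a (T ω - l)) = s := by
        rcases eq_or_ne (min a (T ω - l)) 0 with h0 | h0
        · rw [h0] at hsm ⊢; linarith
        · field_simp
      simp only [e2]
      rw [norm_eq_zero, sub_eq_zero]
      exact h3
    · rintro ⟨r, h⟩
      rw [norm_eq_zero, sub_eq_zero] at h
      have hs1 : 0 ≤ min a (T ω - l) * (r : ℝ) := mul_nonneg hm r.2.1
      have hs2 : min a (T ω - l) * (r : ℝ) ≤ min a (T ω - l) * 1 :=
        mul_le_mul_of_nonneg_left r.2.2 hm
      rw [mul_one] at hs2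
      refine le_trans (csInf_le ⟨0, fun x hx => hx.1.1⟩
        ⟨⟨hs1, hs2.trans (min_le_right _ _)⟩, h⟩) (hs2.trans (min_le_left _ _))

/-- one excision step -/
def erStep (q : (ℝ → Euc d) × ℝ) : (ℝ → Euc d) × ℝ :=
  (fun u => q.1 (if u ≤ loopStart q.1 q.2 then u else u + loopLen q.1 q.2), q.2 - loopLen q.1 q.2)

/-- iterated excision -/
def er (c : ℝ → Euc d) (T : ℝ) (k : ℕ) : (ℝ → Euc d) × ℝ := erStep^[k] (c, T)

/-- good state -/
def erGood (q : (ℝ → Euc d) × ℝ) : Prop :=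
  0 ≤ q.2 ∧ LipschitzWith 1 q.1 ∧ ∀ t, q.2 ≤ t → q.1 t = q.1 q.2

lemma erGood_step {q : (ℝ → Euc d) × ℝ} (h : erGood q) : erGood (erStep q) ∧
    (erStep q).1 (erStep q).2 = q.1 q.2 ∧ (erStep q).1 0 = q.1 0 := by
  obtain ⟨h0, h1, h2⟩ := h
  obtain ⟨⟨hs0, hs1⟩, hs2⟩ := loopStart_mem h1.continuous h0
  obtain ⟨⟨hl0, hl1⟩, -⟩ := loopLen_mem h1.continuous h0
  unfold erStep
  set s := loopStart q.1 q.2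
  set l := loopLen q.1 q.2
  have hend : ∀ t, q.2 - l ≤ t → q.1 (if t ≤ s then t else t + l) = q.1 q.2 := by
    intro t ht
    split_ifs with h
    · have : t = s := by linarith
      rw [this, hs2]
      exact h2 _ (by linarith)
    · exact h2 _ (by linarith)
  refine ⟨⟨by simp; linarith, ?_, ?_⟩, hend _ le_rfl, by simp [hs0]⟩
  · simp only
    have key : ∀ u v, u ≤ v → dist (q.1 (if u ≤ s then u else u + l))
        (q.1 (if v ≤ s then v else v + l)) ≤ v - u := by
      intro u v huv
      have hd : ∀ x y, x ≤ y → dist (q.1 x) (q.1 y) ≤ y - x := by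
        intro x y hxy
        have := h1.dist_le_mul x y
        rw [Real.dist_eq, abs_sub_comm, abs_of_nonneg (by linarith)] at this
        simpa using this
      split_ifs with ha hb hb
      · exact hd _ _ huv
      · refine (dist_triangle _ (q.1 s) _).trans ?_
        have e1 := hd u s ha
        have e2 := hd (s + l) (v + l) (by linarith)
        rw [← hs2] at e2
        linarith
      · linarith
      · have := hd (u + l) (v + l) (by linarith)
        linarith
    refine LipschitzWith.of_dist_le_mul fun u v => ?_
    rcases le_total u v with h | h
    · rw [Real.dist_eq, abs_sub_comm, abs_of_nonneg (by linarith)]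
      simpa using key u v h
    · rw [Real.dist_eq, abs_of_nonneg (by linarith), dist_comm]
      simpa using key v u h
  · intro t ht
    simp only
    rw [hend t ht, hend _ le_rfl]

lemma er_succ (c : ℝ → Euc d) (T : ℝ) (k : ℕ) : er c T (k + 1) = erStep (er c T k) :=
  Function.iterate_succ_apply' _ _ _

lemma erGood_er {c : ℝ → Euc d} {T : ℝ} (h : erGood (c, T)) (k : ℕ) : erGood (er c T k) ∧
    (er c T k).1 (er c T k).2 = c T ∧ (er c T k).1 0 = c 0 := by
  induction k with
  | zero => exact ⟨h, rfl, rfl⟩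
  | succ k ih =>
    rw [er_succ]
    obtain ⟨h1, h2, h3⟩ := erGood_step ih.1
    exact ⟨h1, h2.trans ih.2.1, h3.trans ih.2.2⟩

lemma er_limit {c : ℕ → ℝ → Euc d} {T l s : ℕ → ℝ} {T' : ℝ} (hc : Continuous (c 0))
    (hl : ∀ k, 0 ≤ l k)
    (hT : ∀ k, T (k + 1) = T k - l k) (hT' : ∀ k, T' ≤ T k)
    (hcs : ∀ k u, c (k + 1) u = c k (if u ≤ s k then u else u + l k)) :
    ∃ σ : ℝ → ℝ, (∀ u v, u ≤ v → v - u ≤ σ v - σ u) ∧ (∀ u, u ≤ σ u ∧ σ u ≤ u + T 0 - T') ∧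
      ∀ u, Tendsto (fun k => c k u) atTop (𝓝 (c 0 (σ u))) := by
  set e : ℕ → ℝ → ℝ := fun k u => if u ≤ s k then u else u + l k with he
  have he1 : ∀ k u, u ≤ e k u := by
    intro k u; simp only [he]; split_ifs <;> linarith [hl k]
  have he2 : ∀ k u, e k u ≤ u + l k := by
    intro k u; simp only [he]; split_ifs <;> linarith [hl k]
  have he3 : ∀ k u v, u ≤ v → v - u ≤ e k v - e k u := by
    intro k u v h; simp only [he]; split_ifs <;> linarith [hl k]
  let S : ℕ → ℝ → ℝ := fun k => Nat.rec id (fun k f u => f (e k u)) k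
  have hS0 : ∀ u, S 0 u = u := fun u => rfl
  have hS : ∀ k u, S (k + 1) u = S k (e k u) := fun k u => rfl
  have hcS : ∀ k u, c k u = c 0 (S k u) := by
    intro k
    induction k with
    | zero => intro u; rw [hS0]
    | succ k ih => intro u; rw [hcs, ih, hS]
  have hexp : ∀ k u v, u ≤ v → v - u ≤ S k v - S k u := by
    intro k
    induction k with
    | zero => intro u v h; rw [hS0, hS0]
    | succ k ih =>
      intro u v h
      rw [hS, hS]
      have h1 := he3 k u v h
      exact h1.trans (ih _ _ (by linarith))
  have hub : ∀ k u, S k u ≤ u + T 0 - T k := by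
    intro k
    induction k with
    | zero => intro u; rw [hS0]; linarith
    | succ k ih =>
      intro u
      rw [hS, hT]
      linarith [ih (e k u), he2 k u]
  have hmono : ∀ u, Monotone fun k => S k u := by
    intro u
    refine monotone_nat_of_le_succ fun k => ?_
    rw [hS]
    linarith [hexp k u (e k u) (he1 k u), he1 k u]
  have hbdd : ∀ u, BddAbove (range fun k => S k u) := by
    intro u
    refine ⟨u + T 0 - T', ?_⟩
    rintro _ ⟨k, rfl⟩
    have := hub k u
    have := hT' k
    simp only
    linarith
  have hlim : ∀ u, Tendsto (fun k => S k u) atTop (𝓝 (⨆ k, S k u)) := fun u =>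
    tendsto_atTop_ciSup (hmono u) (hbdd u)
  refine ⟨fun u => ⨆ k, S k u, ?_, ?_, ?_⟩
  · intro u v h
    exact le_of_tendsto_of_tendsto' tendsto_const_nhds ((hlim v).sub (hlim u))
      (fun k => hexp k u v h)
  · intro u
    refine ⟨le_ciSup (hbdd u) 0, ciSup_le fun k => ?_⟩
    linarith [hub k u, hT' k]
  · intro u
    have := (hc.tendsto _).comp (hlim u)
    refine this.congr fun k => ?_
    simp [hcS k u]

lemma speed_of_expansive {c : ℝ → Euc d} {T T' : ℝ} (h : IsPath c T) {σ : ℝ → ℝ}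
    (hσ : ∀ u v, u ≤ v → v - u ≤ σ v - σ u)
    (hmaps : ∀ u ∈ Icc 0 T', σ u ∈ Icc 0 T) (hlip : LipschitzWith 1 (c ∘ σ)) :
    ∀ᵐ t ∂(volume.restrict (Icc (0 : ℝ) T')), ‖deriv (c ∘ σ) t‖ = 1 := by
  have hmono : Monotone σ := fun u v huv => by linarith [hσ u v huv]
  have hanti : AntilipschitzWith 1 σ := by
    refine AntilipschitzWith.of_le_mul_dist fun u v => ?_
    simp only [NNReal.coe_one, one_mul]
    rcases le_total u v with h | h
    · rw [dist_comm, dist_comm (σ u), Real.dist_eq, Real.dist_eq]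
      exact abs_le_abs_of_nonneg (by linarith) (hσ _ _ h)
    · rw [Real.dist_eq, Real.dist_eq]
      exact abs_le_abs_of_nonneg (by linarith) (hσ _ _ h)
  have hcd : ∀ᵐ t ∂(volume : Measure ℝ), ContinuousAt σ t := by
    rw [ae_iff]
    exact hmono.countable_not_continuousAt.measure_zero _
  have hnull : volume {t | t ∈ Icc 0 T ∧ ¬ (DifferentiableAt ℝ c t ∧ ‖deriv c t‖ = 1)} = 0 := by
    have h1 := (ae_restrict_iff' measurableSet_Icc).1 h.speed
    have h2 : ∀ᵐ t ∂(volume : Measure ℝ), t ∈ Icc 0 T → (DifferentiableAt ℝ c t ∧ ‖deriv c t‖ = 1) := by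
      filter_upwards [h1, h.lip.ae_differentiableAt_real] with t h1 h2 h3
      exact ⟨h2, h1 h3⟩
    rw [ae_iff] at h2
    convert h2 using 3
    ext t
    simp [and_assoc]
  have hgood : ∀ᵐ u ∂(volume : Measure ℝ), σ u ∈ Icc 0 T →
      (DifferentiableAt ℝ c (σ u) ∧ ‖deriv c (σ u)‖ = 1) := by
    rw [ae_iff]
    have h1 := hanti.hausdorffMeasure_preimage_le (d := 1) zero_le_one
      {t | t ∈ Icc 0 T ∧ ¬ (DifferentiableAt ℝ c t ∧ ‖deriv c t‖ = 1)}
    rw [hausdorffMeasure_real, hnull] at h1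
    simp only [mul_zero, nonpos_iff_eq_zero] at h1
    convert h1 using 3
    ext t
    simp [and_assoc]
  rw [ae_restrict_iff' measurableSet_Icc]
  filter_upwards [hcd, hgood, hlip.ae_differentiableAt_real] with u h1 h2 h3 hu
  obtain ⟨h4, h5⟩ := h2 (hmaps u hu)
  refine le_antisymm ?_ ?_
  · simpa using norm_deriv_le_of_lipschitz hlip (x₀ := u)
  · -- slopes
    have hd1 := h3.hasDerivAt.tendsto_slope.norm
    have hsl : Tendsto (fun v => ‖slope c (σ u) (σ v)‖) (𝓝[≠] u) (𝓝 1) := by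
      rw [← h5]
      refine h4.hasDerivAt.tendsto_slope.norm.comp ?_
      refine tendsto_nhdsWithin_of_tendsto_nhds_of_eventually_within _
        ((h1.tendsto).mono_left nhdsWithin_le_nhds) ?_
      filter_upwards [self_mem_nhdsWithin] with v hv
      intro h
      exact hv (hanti.injective h)
    refine le_of_tendsto_of_tendsto hsl hd1 ?_
    filter_upwards [self_mem_nhdsWithin] with v hv
    have hv' : v ≠ u := hv
    rw [slope_def_module, slope_def_module, norm_smul, norm_smul]
    simp only [Function.comp]
    refine mul_le_mul_of_nonneg_right ?_ (norm_nonneg _)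
    rw [norm_inv, norm_inv]
    have : 0 < ‖v - u‖ := norm_pos_iff.2 (sub_ne_zero.2 hv')
    refine inv_anti₀ this ?_
    have := hanti.le_mul_dist v u
    simpa [dist_eq_norm] using this

end LoopErase

section LoopErase2
variable {d : ℕ}

lemma er_path {c : ℝ → Euc d} {T : ℝ} (h : IsPath c T) :
    ∃ (c' : ℝ → Euc d) (T' : ℝ), (∀ u, Tendsto (fun k => (er c T k).1 u) atTop (𝓝 (c' u))) ∧
      Tendsto (fun k => (er c T k).2) atTop (𝓝 T') ∧ IsPath c' T' ∧ InjOn c' (Icc 0 T') ∧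
      c' '' Icc 0 T' ⊆ c '' Icc 0 T ∧ c' 0 = c 0 ∧ c' T' = c T := by
  have hg := fun k => erGood_er (c := c) (T := T) ⟨h.T0, h.lip, h.halts⟩ k
  set cc : ℕ → ℝ → Euc d := fun k => (er c T k).1 with hcc
  set TT : ℕ → ℝ := fun k => (er c T k).2 with hTT
  set ll : ℕ → ℝ := fun k => loopLen (cc k) (TT k) with hll
  set ss : ℕ → ℝ := fun k => loopStart (cc k) (TT k) with hss
  have hl0 : ∀ k, 0 ≤ ll k := fun k => (loopLen_mem (hg k).1.2.1.continuous (hg k).1.1).1.1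
  have hTs : ∀ k, TT (k + 1) = TT k - ll k := by
    intro k; simp only [hTT, er_succ]; rfl
  have hcs : ∀ k u, cc (k + 1) u = cc k (if u ≤ ss k then u else u + ll k) := by
    intro k u; simp only [hcc, er_succ]; rfl
  have hanti : Antitone TT := antitone_nat_of_succ_le fun k => by
    rw [hTs]; linarith [hl0 k]
  have hbdd : BddBelow (range TT) := ⟨0, by rintro _ ⟨k, rfl⟩; exact (hg k).1.1⟩
  set T' := ⨅ k, TT k with hT'
  have hT'lim : Tendsto TT atTop (𝓝 T') := tendsto_atTop_ciInf hanti hbdd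
  have hT'le : ∀ k, T' ≤ TT k := fun k => ciInf_le hbdd k
  have hT'0 : 0 ≤ T' := le_ciInf fun k => (hg k).1.1
  have hlim : ∀ n, ∃ σ : ℝ → ℝ, (∀ u v, u ≤ v → v - u ≤ σ v - σ u) ∧
      (∀ u, u ≤ σ u ∧ σ u ≤ u + TT n - T') ∧
      ∀ u, Tendsto (fun k => cc k u) atTop (𝓝 (cc n (σ u))) := by
    intro n
    obtain ⟨σ, h1, h2, h3⟩ := er_limit (c := fun k => cc (n + k)) (T := fun k => TT (n + k))
      (l := fun k => ll (n + k)) (s := fun k => ss (n + k)) (T' := T')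
      (hg n).1.2.1.continuous (fun k => hl0 _) (fun k => hTs (n + k)) (fun k => hT'le _)
      (fun k u => hcs (n + k) u)
    refine ⟨σ, h1, h2, fun u => ?_⟩
    have := h3 u
    simp_rw [add_comm n] at this
    rw [tendsto_add_atTop_iff_nat (f := fun k => cc k u) n] at this
    simpa using this
  obtain ⟨σ, hσ1, hσ2, hσ3⟩ := hlim 0
  have hc0 : cc 0 = c := rfl
  have hT0 : TT 0 = T := rfl
  rw [hT0] at hσ2
  rw [hc0] at hσ3
  have hmaps : ∀ u ∈ Icc 0 T', σ u ∈ Icc 0 T := by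
    intro u hu
    have := hσ2 u
    exact ⟨hu.1.trans this.1, by linarith [hu.2]⟩
  have hlip : LipschitzWith 1 (c ∘ σ) := by
    refine LipschitzWith.of_dist_le_mul fun u v => ?_
    exact le_of_tendsto' ((hσ3 u).dist (hσ3 v)) fun k => (hg k).1.2.1.dist_le_mul u v
  have hend0 : ∀ t, T' < t → c (σ t) = c T := by
    intro t ht
    refine tendsto_nhds_unique (hσ3 t) ?_
    refine tendsto_const_nhds.congr' ?_
    filter_upwards [hT'lim.eventually (gt_mem_nhds ht)] with k hk
    rw [← (hg k).2.1]
    exact ((hg k).1.2.2 t hk.le).symm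
  have hend1 : c (σ T') = c T := by
    have h1 : Tendsto (c ∘ σ) (𝓝[>] T') (𝓝 (c (σ T'))) :=
      (hlip.continuous.tendsto T').mono_left nhdsWithin_le_nhds
    refine tendsto_nhds_unique h1 ?_
    refine tendsto_const_nhds.congr' ?_
    filter_upwards [self_mem_nhdsWithin] with t ht
    exact (hend0 t ht).symm
  refine ⟨c ∘ σ, T', hσ3, hT'lim, ⟨hT'0, hlip, speed_of_expansive h hσ1 hmaps hlip, ?_⟩, ?_, ?_,
    ?_, hend1⟩
  · intro t ht
    rcases ht.eq_or_lt with rfl | ht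
    · rfl
    · exact (hend0 t ht).trans hend1.symm
  · -- injective
    have key : ∀ a b, a ∈ Icc 0 T' → b ∈ Icc 0 T' → a < b → (c ∘ σ) a ≠ (c ∘ σ) b := by
      intro a b ha hb hab heq
      have hge : ∀ n, b - a ≤ ll n := by
        intro n
        obtain ⟨τ, h1, h2, h3⟩ := hlim n
        have ea := tendsto_nhds_unique (hσ3 a) (h3 a)
        have eb := tendsto_nhds_unique (hσ3 b) (h3 b)
        have e : cc n (τ a) = cc n (τ b) := by
          rw [← ea, ← eb]; exact heq
        have h4 := h1 a b hab.le
        refine h4.trans (le_loopLen (ha.1.trans (h2 a).1) (by linarith) ?_ e)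
        linarith [(h2 b).2, hb.2]
      have hl : Tendsto ll atTop (𝓝 0) := by
        have h1 : Tendsto (fun k => TT k - TT (k + 1)) atTop (𝓝 (T' - T')) :=
          hT'lim.sub ((tendsto_add_atTop_iff_nat 1).2 hT'lim)
        rw [sub_self] at h1
        refine h1.congr fun k => ?_
        rw [hTs]; ring
      have := ge_of_tendsto' hl hge
      linarith
    intro a ha b hb heq
    rcases lt_trichotomy a b with h | h | h
    · exact absurd heq (key a b ha hb h)
    · exact h
    · exact absurd heq.symm (key b a hb ha h)
  · rintro _ ⟨u, hu, rfl⟩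
    exact ⟨σ u, hmaps u hu, rfl⟩
  · refine tendsto_nhds_unique (hσ3 0) ?_
    refine tendsto_const_nhds.congr fun k => ?_
    exact (hg k).2.2.symm

namespace Fam
variable {Ω : Type*} [MeasurableSpace Ω]

lemma measurable_er (f : Fam Ω d) (k : ℕ) :
    Measurable (fun q : Ω × ℝ => (er (f.γ q.1) (f.T q.1) k).1 q.2) ∧
    Measurable (fun ω => (er (f.γ ω) (f.T ω) k).2) := by
  have hg := fun ω k => erGood_er (c := f.γ ω) (T := f.T ω)
    ⟨(f.path ω).T0, (f.path ω).lip, (f.path ω).halts⟩ k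
  induction k with
  | zero => exact ⟨f.meas, f.measT⟩
  | succ k ih =>
    obtain ⟨h1, h2⟩ := ih
    have hL := measurable_loopLen (c := fun ω => (er (f.γ ω) (f.T ω) k).1)
      (T := fun ω => (er (f.γ ω) (f.T ω) k).2) h1 (fun ω => (hg ω k).1.2.1.continuous) h2
      (fun ω => (hg ω k).1.1)
    have hS := measurable_loopStart (c := fun ω => (er (f.γ ω) (f.T ω) k).1)
      (T := fun ω => (er (f.γ ω) (f.T ω) k).2) h1 (fun ω => (hg ω k).1.2.1.continuous) h2
      (fun ω => (hg ω k).1.1)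
    simp_rw [er_succ]
    refine ⟨?_, h2.sub hL⟩
    have hm : Measurable (fun q : Ω × ℝ =>
        if q.2 ≤ loopStart (er (f.γ q.1) (f.T q.1) k).1 (er (f.γ q.1) (f.T q.1) k).2 then q.2
        else q.2 + loopLen (er (f.γ q.1) (f.T q.1) k).1 (er (f.γ q.1) (f.T q.1) k).2) := ?_
    · exact h1.comp (measurable_fst.prodMk hm)
    refine Measurable.ite (measurableSet_le measurable_snd (hS.comp measurable_fst))
      measurable_snd (measurable_snd.add (hL.comp measurable_fst))

lemma exists_inj (f : Fam Ω d) : ∃ f' : Fam Ω d, (∀ ω, InjOn (f'.γ ω) (Icc 0 (f'.T ω))) ∧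
    (∀ ω, f'.im ω ⊆ f.im ω) ∧ (∀ ω, f'.γ ω 0 = f.γ ω 0) ∧
    (∀ ω, f'.γ ω (f'.T ω) = f.γ ω (f.T ω)) := by
  choose c T h1 h2 h3 h4 h5 h6 h7 using fun ω => er_path (f.path ω)
  refine ⟨⟨c, T, ?_, ?_, h3⟩, h4, h5, h6, h7⟩
  · refine measurable_of_tendsto_metrizable (fun k => (f.measurable_er k).1) ?_
    rw [tendsto_pi_nhds]
    rintro ⟨ω, u⟩
    exact h1 ω u
  · refine measurable_of_tendsto_metrizable (fun k => (f.measurable_er k).2) ?_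
    rw [tendsto_pi_nhds]
    exact h2

lemma occ_mono (f f' : Fam Ω d) (P : Measure Ω) [SFinite P] (h : ∀ ω, f'.im ω ⊆ f.im ω) :
    f'.occ P ≤ f.occ P := by
  rw [Measure.le_iff]
  intro B hB
  have hB' : Measurable (B.indicator (fun _ => (1 : ℝ≥0∞))) := measurable_const.indicator hB
  have e : ∀ g : Fam Ω d, g.occ P B = ∫⁻ x, B.indicator (fun _ => (1 : ℝ≥0∞)) x ∂(g.occ P) := by
    intro g
    rw [lintegral_indicator hB]; simp
  rw [e, e, lintegral_occ _ _ hB', lintegral_occ _ _ hB']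
  exact lintegral_mono fun ω => lintegral_mono_set (h ω)

lemma F_mono (f f' : Fam Ω d) (P : Measure Ω) [IsFiniteMeasure P] (h : ∀ ω, f'.im ω ⊆ f.im ω)
    {α : ℝ} (hα : α ∈ Ioo (0 : ℝ) 1) : f'.F P α ≤ f.F P α := by
  have h1 := concave_compare hα (f.measurable_mult P) (f'.measurable_mult P) (f.mult_ne_top P)
    (f'.mult_ne_top P) (compat f f' P P)
  refine h1.trans ?_
  have h2 : ∫⁻ x, f.mult P x ^ (α - 1) ∂(f'.occ P) ≤ f.F P α :=
    lintegral_mono' (f.occ_mono f' P h) le_rfl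
  calc _ ≤ ENNReal.ofReal (1 - α) * f.F P α + ENNReal.ofReal α * f.F P α := by
        gcongr; exact le_rfl
    _ = f.F P α := by
        rw [← add_mul, ← ENNReal.ofReal_add (by linarith [hα.2]) hα.1.le]
        simp

/-- time-based cost integrand -/
lemma F_eq (f : Fam Ω d) (P : Measure Ω) [SFinite P] (α : ℝ) :
    f.F P α = ∫⁻ ω, ∫⁻ t in firstSet (f.γ ω) (f.T ω), f.mult P (f.γ ω t) ^ (α - 1) ∂volume ∂P := by
  rw [F, lintegral_occ _ _ ((f.measurable_mult P).pow_const _)]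
  refine lintegral_congr fun ω => ?_
  exact (f.path ω).lintegral_im ((f.measurable_mult P).pow_const _)

end Fam
end LoopErase2

section PlanOf
variable {d : ℕ}

lemma exists_param {Ω : Type*} [MeasurableSpace Ω] [StandardBorelSpace Ω] [Nonempty Ω]
    (P : Measure Ω) [IsFiniteMeasure P] :
    ∃ r : ℝ → Ω, Measurable r ∧ (volume.restrict (Icc 0 (P univ).toReal)).map r = P := by
  rcases eq_or_ne P 0 with rfl | hP
  · obtain ⟨ω⟩ := ‹Nonempty Ω›
    refine ⟨fun _ => ω, measurable_const, ?_⟩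
    simp
  set M := (P univ).toReal with hM
  have hMp : 0 < M := ENNReal.toReal_pos (by simpa using hP) (measure_ne_top _ _)
  have hMe : ENNReal.ofReal M = P univ := ENNReal.ofReal_toReal (measure_ne_top _ _)
  have : IsProbabilityMeasure ((P univ)⁻¹ • P) := by
    constructor
    simp [ENNReal.inv_mul_cancel (by simpa using hP : P univ ≠ 0) (measure_ne_top _ _)]
  obtain ⟨f, hf, hfm⟩ := ProbabilityTheory.Kernel.exists_measurable_map_eq_unitInterval
    (ProbabilityTheory.Kernel.const Unit ((P univ)⁻¹ • P))
  have hf1 : Measurable (f ()) := hf.comp (measurable_const.prodMk measurable_id)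
  have hfm1 := hfm ()
  rw [ProbabilityTheory.Kernel.const_apply] at hfm1
  have hproj : Measurable (projIcc (0 : ℝ) 1 zero_le_one) := continuous_projIcc.measurable
  have hdiv : Measurable (fun θ : ℝ => M⁻¹ * θ) := by fun_prop
  have e1 : (volume.restrict (Icc 0 M)).map (fun θ : ℝ => M⁻¹ * θ) =
      ENNReal.ofReal M • volume.restrict (Icc 0 1) := by
    have h1 := Real.map_volume_mul_left (a := M⁻¹) (by positivity)
    have h2 : Icc 0 M = (fun θ : ℝ => M⁻¹ * θ) ⁻¹' (Icc 0 1) := by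
      ext θ
      simp only [mem_Icc, mem_preimage]
      rw [mul_nonneg_iff_of_pos_left (by positivity), inv_mul_le_iff₀ hMp, mul_one]
    rw [h2, ← Measure.restrict_map hdiv measurableSet_Icc, h1, Measure.restrict_smul]
    simp [abs_of_pos hMp]
  have e2 : (volume.restrict (Icc (0 : ℝ) 1)).map (projIcc (0 : ℝ) 1 zero_le_one) =
      (volume : Measure unitInterval) := by
    rw [← map_comap_subtype_coe measurableSet_Icc, Measure.map_map hproj measurable_subtype_coe]
    have : (projIcc (0 : ℝ) 1 zero_le_one) ∘ (Subtype.val : Icc (0 : ℝ) 1 → ℝ) = id := by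
      ext x; simp
    rw [this, Measure.map_id]
    rfl
  refine ⟨fun θ => f () (projIcc 0 1 zero_le_one (M⁻¹ * θ)), hf1.comp (hproj.comp hdiv), ?_⟩
  have e3 : (fun θ => f () (projIcc 0 1 zero_le_one (M⁻¹ * θ))) =
      f () ∘ (projIcc (0 : ℝ) 1 zero_le_one) ∘ (fun θ => M⁻¹ * θ) := rfl
  rw [e3, ← Measure.map_map hf1 (hproj.comp hdiv), ← Measure.map_map hproj hdiv, e1,
    Measure.map_smul, e2, Measure.map_smul, hfm1, hMe, smul_smul,
    ENNReal.mul_inv_cancel (by simpa using hP) (measure_ne_top _ _), one_smul]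

lemma IsPath.exists_nonneg {c : ℝ → Euc d} {T : ℝ} (h : IsPath c T) (x : Euc d) :
    (∃ t, 0 ≤ t ∧ c t = x) ↔ x ∈ c '' Icc 0 T := by
  constructor
  · rintro ⟨t, ht, rfl⟩
    rcases le_total t T with h1 | h1
    · exact ⟨t, ⟨ht, h1⟩, rfl⟩
    · exact ⟨T, ⟨h.T0, le_rfl⟩, (h.halts t h1).symm⟩
  · rintro ⟨t, ht, rfl⟩
    exact ⟨t, ht.1, rfl⟩

lemma IsPath.cost_inner {c : ℝ → Euc d} {T : ℝ} (h : IsPath c T) (φ : ℝ → ℝ≥0∞) :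
    ∫⁻ t in Ici (0 : ℝ), φ t * ENNReal.ofReal ‖deriv c t‖ = ∫⁻ t in Icc 0 T, φ t := by
  have e : Ici (0 : ℝ) = Icc 0 T ∪ Ioi T := by
    rw [Icc_union_Ioi_eq_Ici h.T0]
  have hd : Disjoint (Icc 0 T) (Ioi T) := by
    rw [Set.disjoint_left]
    intro t h1 h2
    exact absurd h1.2 (not_le.2 h2)
  rw [e, lintegral_union measurableSet_Ioi hd]
  have h1 : ∫⁻ t in Ioi T, φ t * ENNReal.ofReal ‖deriv c t‖ = 0 := by
    rw [← lintegral_zero (μ := volume.restrict (Ioi T))]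
    refine setLIntegral_congr_fun measurableSet_Ioi fun t ht => ?_
    have : c =ᶠ[𝓝 t] fun _ => c T := by
      filter_upwards [lt_mem_nhds ht] with s hs
      exact h.halts s hs.le
    simp [this.deriv_eq]
  rw [h1, add_zero]
  refine lintegral_congr_ae ?_
  filter_upwards [h.speed] with t ht
  simp [ht]

namespace Fam
variable {Ω : Type*} [MeasurableSpace Ω]

lemma measurable_end (f : Fam Ω d) : Measurable (fun ω => f.γ ω (f.T ω)) :=
  f.meas.comp (measurable_id.prodMk f.measT)

theorem irrigationCost_le [StandardBorelSpace Ω] [Nonempty Ω] (f : Fam Ω d) (P : Measure Ω)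
    [IsFiniteMeasure P] (h0 : ∀ ω, f.γ ω 0 = 0) {α : ℝ} (hα : α ∈ Ioo (0 : ℝ) 1) :
    irrigationCost α (P.map (fun ω => f.γ ω (f.T ω))) ≤ f.F P α := by
  obtain ⟨f', hinj, him, hst, hend⟩ := f.exists_inj
  refine le_trans ?_ (f.F_mono f' P him hα)
  have : (fun ω => f.γ ω (f.T ω)) = (fun ω => f'.γ ω (f'.T ω)) := by
    ext1 ω; rw [hend]
  rw [this]
  obtain ⟨r, hr, hrm⟩ := exists_param P
  have hM : ((P.map (fun ω => f'.γ ω (f'.T ω))) univ) = P univ := by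
    rw [Measure.map_apply f'.measurable_end MeasurableSet.univ, preimage_univ]
  let χ : IrrigationPlan (P.map (fun ω => f'.γ ω (f'.T ω))) :=
    { toFun := fun θ => f'.γ (r θ)
      T := fun θ => f'.T (r θ)
      measurable := f'.meas.comp ((hr.comp measurable_fst).prodMk measurable_snd)
      T_nonneg := fun θ => (f'.path _).T0
      lipschitz := fun θ _ => (f'.path _).lip
      unit_speed := fun θ _ => (f'.path _).speed
      stopped := fun θ _ => (f'.path _).halts
      start := fun θ _ => by rw [hst, h0]
      irrigates := by
        rw [hM]
        conv_rhs => rw [← hrm]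
        rw [Measure.map_map f'.measurable_end hr]
        rfl }
  refine (iInf_le _ χ).trans (le_of_eq ?_)
  have hmult : ∀ x, χ.mult x = f'.mult P x := by
    intro x
    unfold IrrigationPlan.mult Fam.mult
    conv_rhs => rw [← hrm]
    rw [Measure.map_apply hr (f'.measurable_thru x), Measure.restrict_apply
      (hr (f'.measurable_thru x)), hM, inter_comm]
    congr 1
    ext θ
    simp only [mem_ofPred_eq, mem_inter_iff, mem_preimage]
    refine and_congr_right fun _ => ?_
    exact (f'.path (r θ)).exists_nonneg x
  rw [IrrigationPlan.cost, F_eq]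
  simp_rw [hmult]
  have hfirst : ∀ ω, firstSet (f'.γ ω) (f'.T ω) = Icc 0 (f'.T ω) := by
    intro ω
    refine Subset.antisymm firstSet_subset fun t ht => ⟨ht, fun s hs hst h => ?_⟩
    exact hst.ne (hinj ω ⟨hs, hst.le.trans ht.2⟩ ht h)
  have hG : Measurable (fun ω => ∫⁻ t in firstSet (f'.γ ω) (f'.T ω),
      f'.mult P (f'.γ ω t) ^ (α - 1) ∂volume) := by
    have hφ : Measurable (fun x => f'.mult P x ^ (α - 1)) := (f'.measurable_mult P).pow_const _
    have := (f'.measurable_path_integral (Y := Unit) (φ := fun _ _ x => f'.mult P x ^ (α - 1))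
      (hφ.comp (measurable_snd.comp measurable_snd))).comp
      ((measurable_const (a := ())).prodMk measurable_id)
    convert this using 1
    ext1 ω
    exact ((f'.path ω).lintegral_im hφ).symm
  have hrm2 : ∀ G : Ω → ℝ≥0∞, Measurable G →
      ∫⁻ ω, G ω ∂P = ∫⁻ θ in Icc 0 (P univ).toReal, G (r θ) := by
    intro G hG
    rw [← lintegral_map hG hr, hrm]
  rw [hrm2 _ hG, hM]
  refine lintegral_congr fun θ => ?_
  rw [hfirst]
  exact (f'.path (r θ)).cost_inner _

end Fam
end PlanOf

section PathOps
variable {d : ℕ}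

lemma ae_Icc_iff_Ioo {T : ℝ} {p : ℝ → Prop} :
    (∀ᵐ t ∂(volume.restrict (Icc (0 : ℝ) T)), p t) ↔ ∀ᵐ t ∂(volume : Measure ℝ), t ∈ Ioo 0 T → p t := by
  rw [← ae_restrict_iff' measurableSet_Ioo, Measure.restrict_congr_set Ioo_ae_eq_Icc]

lemma IsPath.const (x : Euc d) : IsPath (fun _ => x) 0 :=
  ⟨le_rfl, (LipschitzWith.const x).weaken zero_le_one, by simp, fun _ _ => rfl⟩

lemma IsPath.stopAt {c : ℝ → Euc d} {T τ : ℝ} (h : IsPath c T) (h0 : 0 ≤ τ) (h1 : τ ≤ T) :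
    IsPath (fun t => c (min t τ)) τ := by
  refine ⟨h0, ?_, ?_, ?_⟩
  · have := h.lip.comp (LipschitzWith.id.min_const τ)
    simpa [Function.comp_def] using this
  · rw [ae_Icc_iff_Ioo]
    have := ae_Icc_iff_Ioo.1 h.speed
    filter_upwards [this] with t ht htm
    have e : (fun t => c (min t τ)) =ᶠ[𝓝 t] c := by
      filter_upwards [gt_mem_nhds htm.2] with s hs
      rw [min_eq_left hs.le]
    rw [e.deriv_eq]
    exact ht ⟨htm.1, htm.2.trans_le h1⟩
  · intro t ht
    simp [ht]

lemma IsPath.tail {c : ℝ → Euc d} {T τ : ℝ} (h : IsPath c T) (h0 : 0 ≤ τ) (h1 : τ ≤ T) :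
    IsPath (fun t => c (t + τ)) (T - τ) := by
  refine ⟨by linarith, ?_, ?_, ?_⟩
  · have := h.lip.comp (LipschitzWith.of_dist_le_mul (f := fun t : ℝ => t + τ) (K := 1)
      (fun x y => by simp))
    simpa [Function.comp_def] using this
  · rw [ae_Icc_iff_Ioo]
    have h2 := ae_Icc_iff_Ioo.1 h.speed
    have h3 := (measurePreserving_add_right volume τ).quasiMeasurePreserving.ae h2
    filter_upwards [h3] with t ht htm
    rw [deriv_comp_add_const]
    exact ht ⟨by linarith [htm.1], by linarith [htm.2]⟩
  · intro t ht
    rw [h.halts (t + τ) (by linarith), sub_add_cancel]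

/-- concatenation -/
def concat (c₁ : ℝ → Euc d) (T₁ : ℝ) (c₂ : ℝ → Euc d) (t : ℝ) : Euc d :=
  if t ≤ T₁ then c₁ t else c₂ (t - T₁)

lemma IsPath.concat {c₁ c₂ : ℝ → Euc d} {T₁ T₂ : ℝ} (h₁ : IsPath c₁ T₁) (h₂ : IsPath c₂ T₂)
    (h : c₁ T₁ = c₂ 0) : IsPath (concat c₁ T₁ c₂) (T₁ + T₂) := by
  have hd : ∀ {c : ℝ → Euc d}, LipschitzWith 1 c → ∀ x y, x ≤ y → dist (c x) (c y) ≤ y - x := by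
    intro c hc x y hxy
    have := hc.dist_le_mul x y
    rw [Real.dist_eq, abs_sub_comm, abs_of_nonneg (by linarith)] at this
    simpa using this
  refine ⟨add_nonneg h₁.T0 h₂.T0, ?_, ?_, ?_⟩
  · have key : ∀ u v, u ≤ v → dist (_root_.concat c₁ T₁ c₂ u) (_root_.concat c₁ T₁ c₂ v) ≤ v - u := by
      intro u v huv
      unfold _root_.concat
      split_ifs with ha hb hb
      · exact hd h₁.lip _ _ huv
      · refine (dist_triangle _ (c₁ T₁) _).trans ?_
        have e1 := hd h₁.lip u T₁ ha
        have e2 := hd h₂.lip 0 (v - T₁) (by linarith)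
        rw [← h] at e2
        linarith
      · linarith
      · have := hd h₂.lip (u - T₁) (v - T₁) (by linarith)
        linarith
    refine LipschitzWith.of_dist_le_mul fun u v => ?_
    rcases le_total u v with h | h
    · rw [Real.dist_eq, abs_sub_comm, abs_of_nonneg (by linarith)]
      simpa using key u v h
    · rw [Real.dist_eq, abs_of_nonneg (by linarith), dist_comm]
      simpa using key v u h
  · rw [ae_Icc_iff_Ioo]
    have e1 := ae_Icc_iff_Ioo.1 h₁.speed
    have e2 := ae_Icc_iff_Ioo.1 h₂.speed
    have e3 := (measurePreserving_sub_right volume T₁).quasiMeasurePreserving.ae e2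
    have e4 : ∀ᵐ t ∂(volume : Measure ℝ), t ≠ T₁ := by
      simp [ae_iff]
    filter_upwards [e1, e3, e4] with t h1 h3 h4 ht
    rcases lt_or_gt_of_ne h4 with hlt | hgt
    · have e : _root_.concat c₁ T₁ c₂ =ᶠ[𝓝 t] c₁ := by
        filter_upwards [gt_mem_nhds hlt] with s hs
        simp [_root_.concat, hs.le]
      rw [e.deriv_eq]
      exact h1 ⟨ht.1, hlt⟩
    · have e : _root_.concat c₁ T₁ c₂ =ᶠ[𝓝 t] fun s => c₂ (s - T₁) := by
        filter_upwards [lt_mem_nhds hgt] with s hs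
        simp [_root_.concat, not_le.2 hs]
      rw [e.deriv_eq, deriv_comp_sub_const]
      exact h3 ⟨by linarith, by linarith [ht.2]⟩
  · have key : ∀ t, T₁ + T₂ ≤ t → _root_.concat c₁ T₁ c₂ t = c₂ T₂ := by
      intro t ht
      unfold _root_.concat
      have := h₂.T0
      split_ifs with h'
      · have : t = T₁ := by linarith
        have h2 : T₂ = 0 := by linarith
        rw [this, h, h2]
      · exact h₂.halts _ (by linarith)
    intro t ht
    rw [key t ht, key _ le_rfl]

lemma concat_end {c₁ c₂ : ℝ → Euc d} {T₁ T₂ : ℝ} (h₂ : 0 ≤ T₂)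
    (h : c₁ T₁ = c₂ 0) : concat c₁ T₁ c₂ (T₁ + T₂) = c₂ T₂ := by
  unfold concat
  split_ifs with h'
  · have h2 : T₂ = 0 := by linarith
    rw [h2, add_zero, h]
  · congr 1; ring

lemma concat_im {c₁ c₂ : ℝ → Euc d} {T₁ T₂ : ℝ} :
    concat c₁ T₁ c₂ '' Icc 0 (T₁ + T₂) ⊆ c₁ '' Icc 0 T₁ ∪ c₂ '' Icc 0 T₂ := by
  rintro _ ⟨t, ht, rfl⟩
  unfold concat
  split_ifs with h'
  · exact Or.inl ⟨t, ⟨ht.1, h'⟩, rfl⟩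
  · exact Or.inr ⟨t - T₁, ⟨by linarith, by linarith [ht.2]⟩, rfl⟩

lemma concat_zero {c₁ c₂ : ℝ → Euc d} {T₁ : ℝ} (h : 0 ≤ T₁) : concat c₁ T₁ c₂ 0 = c₁ 0 := by
  simp [concat, h]

/-- unit speed segment -/
def seg (y p : Euc d) (t : ℝ) : Euc d := y + (max 0 (min t (dist y p))) • ((dist y p)⁻¹ • (p - y))

lemma seg_zero (y p : Euc d) : seg y p 0 = y := by
  simp [seg]

lemma seg_end (y p : Euc d) : seg y p (dist y p) = p := by
  unfold seg
  rw [min_self, max_eq_right dist_nonneg, smul_smul]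
  rcases eq_or_ne y p with rfl | h
  · simp
  · rw [mul_inv_cancel₀ (dist_ne_zero.2 h)]
    simp

lemma seg_path (y p : Euc d) : IsPath (seg y p) (dist y p) := by
  have hv : ‖((dist y p)⁻¹ • (p - y))‖ ≤ 1 := by
    rw [norm_smul, norm_inv, ← dist_eq_norm, dist_comm p y, Real.norm_eq_abs, abs_of_nonneg dist_nonneg]
    exact inv_mul_le_one
  refine ⟨dist_nonneg, ?_, ?_, ?_⟩
  · refine LipschitzWith.of_dist_le_mul fun u v => ?_
    have h1 : LipschitzWith 1 (fun t : ℝ => max 0 (min t (dist y p))) :=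
      (LipschitzWith.id.min_const _).const_max 0
    have h2 := h1.dist_le_mul u v
    unfold seg
    rw [dist_add_left, dist_eq_norm, ← sub_smul, norm_smul]
    rw [dist_eq_norm] at h2
    calc _ ≤ ‖max 0 (min u (dist y p)) - max 0 (min v (dist y p))‖ * 1 := by gcongr
      _ ≤ _ := by rw [mul_one]; exact h2
  · rw [ae_Icc_iff_Ioo]
    refine Eventually.of_forall fun t ht => ?_
    have e : seg y p =ᶠ[𝓝 t] fun s => y + s • ((dist y p)⁻¹ • (p - y)) := by
      filter_upwards [gt_mem_nhds ht.2, lt_mem_nhds ht.1] with s hs hs2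
      unfold seg
      rw [min_eq_left hs.le, max_eq_right hs2.le]
    have hd : HasDerivAt (fun s : ℝ => y + s • ((dist y p)⁻¹ • (p - y)))
        ((1 : ℝ) • ((dist y p)⁻¹ • (p - y))) t :=
      ((hasDerivAt_id t).smul_const _).const_add y
    rw [e.deriv_eq, hd.deriv, one_smul, norm_smul, norm_inv, ← dist_eq_norm, dist_comm p y,
      Real.norm_eq_abs, abs_of_nonneg dist_nonneg]
    exact inv_mul_cancel₀ (by linarith [ht.1, ht.2])
  · intro t ht
    unfold seg
    rw [min_eq_right ht, min_self]

namespace Fam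
variable {Ω : Type*} [MeasurableSpace Ω]

/-- first hitting time of `x` -/
def hit (f : Fam Ω d) (x : Euc d) (ω : Ω) : ℝ := sInf {t | t ∈ Icc 0 (f.T ω) ∧ f.γ ω t = x}

lemma hit_mem (f : Fam Ω d) {x : Euc d} {ω : Ω} (hx : x ∈ f.im ω) :
    f.hit x ω ∈ Icc 0 (f.T ω) ∧ f.γ ω (f.hit x ω) = x := by
  have : f.hit x ω ∈ {t | t ∈ Icc 0 (f.T ω) ∧ f.γ ω t = x} := by
    refine IsCompact.sInf_mem ?_ ?_
    · exact isCompact_Icc.inter_right (isClosed_eq (f.cont ω) continuous_const)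
    · obtain ⟨t, ht, h⟩ := hx
      exact ⟨t, ht, h⟩
  exact this

lemma hit_nonneg (f : Fam Ω d) (x : Euc d) (ω : Ω) : 0 ≤ f.hit x ω :=
  Real.sInf_nonneg fun _ h => h.1.1

lemma hit_le (f : Fam Ω d) {x : Euc d} {ω : Ω} {t : ℝ} (ht : t ∈ Icc 0 (f.T ω))
    (h : f.γ ω t = x) : f.hit x ω ≤ t :=
  csInf_le ⟨0, fun _ h => h.1.1⟩ ⟨ht, h⟩

lemma hit_first (f : Fam Ω d) {ω : Ω} {t : ℝ} (ht : t ∈ firstSet (f.γ ω) (f.T ω)) :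
    f.hit (f.γ ω t) ω = t := by
  have h1 := f.hit_le ht.1 rfl
  have h2 := f.hit_mem (x := f.γ ω t) (ω := ω) ⟨t, ht.1, rfl⟩
  by_contra hne
  exact ht.2 _ h2.1.1 (lt_of_le_of_ne h1 hne) h2.2

lemma measurable_hit (f : Fam Ω d) : Measurable fun q : Euc d × Ω => f.hit q.1 q.2 := by
  have hc : Measurable (Function.uncurry fun (q : Euc d × Ω) => f.γ q.2) :=
    f.meas.comp ((measurable_snd.comp measurable_fst).prodMk measurable_snd)
  have hA : MeasurableSet {q : Euc d × Ω | q.1 ∈ f.im q.2} := measurable_swap f.measurable_im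
  refine measurable_of_Iic fun a => ?_
  rcases lt_or_ge a 0 with ha | ha
  · convert MeasurableSet.empty
    ext q
    simp only [mem_preimage, mem_Iic, mem_empty_iff_false, iff_false, not_le]
    exact ha.trans_le (f.hit_nonneg _ _)
  · have h1 := measurable_mem_image hc (fun q => f.cont q.2)
      (S := fun q => min a (f.T q.2)) (by have := f.measT; fun_prop) measurable_fst
    convert hA.compl.union h1
    ext q
    simp only [mem_preimage, mem_Iic, mem_union, mem_compl_iff, mem_ofPred_eq]
    constructor
    · intro h
      by_cases hq : q.1 ∈ f.im q.2
      · right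
        have := f.hit_mem hq
        exact ⟨_, ⟨this.1.1, le_min h this.1.2⟩, this.2⟩
      · exact Or.inl hq
    · rintro (h | ⟨t, ht, h⟩)
      · have : {t | t ∈ Icc 0 (f.T q.2) ∧ f.γ q.2 t = q.1} = ∅ := by
          ext t
          simp only [mem_ofPred_eq, mem_empty_iff_false, iff_false]
          rintro ⟨h1, h2⟩
          exact h ⟨t, h1, h2⟩
        rw [hit, this, Real.sInf_empty]
        exact ha
      · exact (f.hit_le ⟨ht.1, ht.2.trans (min_le_right _ _)⟩ h).trans (ht.2.trans (min_le_left _ _))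

/-- cost of the path up to time `t` -/
def zt (f : Fam Ω d) (P : Measure Ω) (α : ℝ) (ω : Ω) (t : ℝ) : ℝ≥0∞ :=
  ∫⁻ s in Icc 0 t, f.mult P (f.γ ω s) ^ (α - 1)

lemma measurable_zt (f : Fam Ω d) (P : Measure Ω) [SFinite P] (α : ℝ) :
    Measurable fun q : Ω × ℝ => f.zt P α q.1 q.2 := by
  have : (fun q : Ω × ℝ => f.zt P α q.1 q.2) = fun q => ∫⁻ s,
      {r : (Ω × ℝ) × ℝ | 0 ≤ r.2 ∧ r.2 ≤ r.1.2}.indicator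
      (fun r => f.mult P (f.γ r.1.1 r.2) ^ (α - 1)) (q, s) := by
    ext1 q
    rw [zt, ← lintegral_indicator measurableSet_Icc]
    rfl
  rw [this]
  refine Measurable.lintegral_prod_right' (f := {r : (Ω × ℝ) × ℝ | 0 ≤ r.2 ∧ r.2 ≤ r.1.2}.indicator
      (fun r => f.mult P (f.γ r.1.1 r.2) ^ (α - 1))) ?_
  refine Measurable.indicator ?_ ?_
  · have h1 : Measurable (fun r : (Ω × ℝ) × ℝ => (r.1.1, r.2)) := by fun_prop
    have h2 : Measurable (fun r : (Ω × ℝ) × ℝ => f.γ r.1.1 r.2) := f.meas.comp h1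
    exact ((f.measurable_mult P).comp h2).pow_const _
  · exact (measurableSet_le measurable_const measurable_snd).inter
      (measurableSet_le measurable_snd (measurable_snd.comp measurable_fst))

end Fam
end PathOps

section Reroute

lemma ennreal_rpow_anti {u v : ℝ≥0∞} {z : ℝ} (hz : z ≤ 0) (h : u ≤ v) : v ^ z ≤ u ^ z := by
  rw [← neg_neg z, ENNReal.rpow_neg v, ENNReal.rpow_neg u]
  exact ENNReal.inv_le_inv.2 (ENNReal.rpow_le_rpow h (by linarith))

variable {d : ℕ}

namespace Fam
variable {Ω : Type*} [MeasurableSpace Ω]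

/-- total time cost -/
def E (f : Fam Ω d) (P : Measure Ω) (α : ℝ) : ℝ≥0∞ := ∫⁻ ω, f.zt P α ω (f.T ω) ∂P

lemma zt_im_le (f : Fam Ω d) (P : Measure Ω) [SFinite P] (α : ℝ) (ω : Ω) :
    ∫⁻ x in f.im ω, f.mult P x ^ (α - 1) ∂μH[1] ≤ f.zt P α ω (f.T ω) :=
  lintegral_image_le (f.path ω).lip ((f.measurable_mult P).pow_const _)

lemma F_le_E (f : Fam Ω d) (P : Measure Ω) [SFinite P] (α : ℝ) : f.F P α ≤ f.E P α := by
  rw [F, lintegral_occ _ _ ((f.measurable_mult P).pow_const _)]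
  exact lintegral_mono fun ω => f.zt_im_le P α ω

open Classical in
lemma exists_reroute (f : Fam Ω d) (h0 : ∀ ω, f.γ ω 0 = 0) (p : Euc d) (θ : Ω) {τ : ℝ}
    (hτ : τ ∈ Icc 0 (f.T θ)) : ∃ f2 : Fam Ω d, (∀ ω, f2.γ ω 0 = 0) ∧
      (∀ ω, f2.γ ω (f2.T ω) = f.γ ω (f.T ω)) ∧ (∀ ω, p ∉ f.im ω → f2.im ω = f.im ω) ∧
      (∀ ω, p ∈ f.im ω → f2.im ω ⊆ f.γ θ '' Icc 0 τ ∪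
        seg (f.γ θ τ) p '' Icc 0 (dist (f.γ θ τ) p) ∪ f.γ ω '' Icc (f.hit p ω) (f.T ω)) := by
  set A : Set Ω := {ω | p ∈ f.im ω} with hA
  have hAm : MeasurableSet A := f.measurable_thru p
  set y := f.γ θ τ with hy
  set c0 : ℝ → Euc d := fun t => f.γ θ (min t τ) with hc0
  have hp0 : IsPath c0 τ := (f.path θ).stopAt hτ.1 hτ.2
  have hy0 : c0 τ = seg y p 0 := by rw [seg_zero]; simp [hc0, hy]
  set c1 := concat c0 τ (seg y p) with hc1
  set L := τ + dist y p with hL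
  have hL0 : 0 ≤ L := add_nonneg hτ.1 dist_nonneg
  have hp1 : IsPath c1 L := hp0.concat (seg_path y p) hy0
  have he1 : c1 L = p := by
    rw [hc1, hL, concat_end dist_nonneg hy0, seg_end]
  have hhit : Measurable (fun ω => f.hit p ω) :=
    f.measurable_hit.comp (measurable_const.prodMk measurable_id)
  set tl : Ω → ℝ → Euc d := fun ω t => f.γ ω (t + f.hit p ω) with htl
  have hjoin : ∀ ω ∈ A, c1 L = tl ω 0 := by
    intro ω hω
    rw [he1, htl]
    simp only [zero_add]
    exact (f.hit_mem hω).2.symm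
  have hpt : ∀ ω ∈ A, IsPath (tl ω) (f.T ω - f.hit p ω) := fun ω hω =>
    (f.path ω).tail (f.hit_mem hω).1.1 (f.hit_mem hω).1.2
  let f2 : Fam Ω d :=
    { γ := fun ω => if ω ∈ A then concat c1 L (tl ω) else f.γ ω
      T := fun ω => if ω ∈ A then L + (f.T ω - f.hit p ω) else f.T ω
      meas := by
        have e : (Function.uncurry fun ω => if ω ∈ A then concat c1 L (tl ω) else f.γ ω) =
            fun q : Ω × ℝ => if q.1 ∈ A then (if q.2 ≤ L then c1 q.2 else
              f.γ q.1 (q.2 - L + f.hit p q.1)) else f.γ q.1 q.2 := by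
          ext1 ⟨ω, t⟩
          simp only [Function.uncurry]
          split_ifs with h1 h2 h2
          · simp [concat, h2]
          · simp [concat, h2, htl]
          · rfl
        rw [e]
        have hm : Measurable (fun q : Ω × ℝ => (q.1, q.2 - L + f.hit p q.1)) := by
          refine measurable_fst.prodMk ?_
          exact (measurable_snd.sub_const _).add (hhit.comp measurable_fst)
        refine Measurable.ite (measurable_fst hAm) (Measurable.ite ?_ ?_ ?_) f.meas
        · exact measurableSet_le measurable_snd measurable_const
        · exact hp1.lip.continuous.measurable.comp measurable_snd
        · exact f.meas.comp hm
      measT := Measurable.ite hAm (measurable_const.add (f.measT.sub hhit)) f.measT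
      path := by
        intro ω
        by_cases h : ω ∈ A
        · simp only [h, if_true]
          exact hp1.concat (hpt ω h) (hjoin ω h)
        · simp only [h, if_false]
          exact f.path ω }
  refine ⟨f2, ?_, ?_, ?_, ?_⟩
  · intro ω
    by_cases h : ω ∈ A
    · simp only [f2, h, if_true]
      rw [concat_zero hL0, hc1, concat_zero hτ.1, hc0]
      simp [hτ.1, h0]
    · simp only [f2, h, if_false, h0]
  · intro ω
    by_cases h : ω ∈ A
    · simp only [f2, h, if_true]
      rw [concat_end (hpt ω h).T0 (hjoin ω h)]
      simp [htl]
    · simp only [f2, h, if_false]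
  · intro ω h
    have h : ω ∉ A := h
    simp only [f2, Fam.im, h, if_false]
  · intro ω h
    have h : ω ∈ A := h
    simp only [f2, Fam.im, h, if_true]
    refine concat_im.trans (union_subset_union ?_ ?_)
    · refine concat_im.trans (union_subset_union ?_ Subset.rfl)
      rintro _ ⟨t, ht, rfl⟩
      exact ⟨t, ht, by simp [hc0, ht.2]⟩
    · rintro _ ⟨t, ht, rfl⟩
      exact ⟨t + f.hit p ω, ⟨by linarith [ht.1], by linarith [ht.2]⟩, rfl⟩

/-- the one-point family of a path -/
def single {c : ℝ → Euc d} {T : ℝ} (h : IsPath c T) : Fam Unit d :=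
  ⟨fun _ => c, fun _ => T, h.lip.continuous.measurable.comp measurable_snd, measurable_const,
    fun _ => h⟩

lemma zt_split (f : Fam Ω d) (P : Measure Ω) (α : ℝ) (ω : Ω) {h T : ℝ}
    (h0 : 0 ≤ h) (h1 : h ≤ T) :
    f.zt P α ω h + ∫⁻ t in Icc h T, f.mult P (f.γ ω t) ^ (α - 1) = f.zt P α ω T := by
  rw [zt, zt, ← Icc_union_Ioc_eq_Icc h0 h1, lintegral_union measurableSet_Ioc,
    setLIntegral_congr Ioc_ae_eq_Icc]
  rw [Set.disjoint_left]
  intro t h2 h3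
  exact absurd h2.2 (not_le.2 h3.1)

theorem reroute [StandardBorelSpace Ω] [Nonempty Ω] (f : Fam Ω d) (P : Measure Ω)
    [IsFiniteMeasure P] (h0 : ∀ ω, f.γ ω 0 = 0) {α : ℝ} (hα : α ∈ Ioo (0 : ℝ) 1)
    (hE : f.E P α ≠ ⊤) (hopt : f.E P α ≤ irrigationCost α (P.map (fun ω => f.γ ω (f.T ω))))
    (p : Euc d) (θ : Ω) {τ : ℝ} (hτ : τ ∈ Icc 0 (f.T θ)) :
    ENNReal.ofReal α * ∫⁻ ω in {ω | p ∈ f.im ω}, f.zt P α ω (f.hit p ω) ∂P ≤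
      ENNReal.ofReal α * (f.mult P p * f.zt P α θ τ) +
        f.mult P p * (f.mult P p ^ (α - 1) * ENNReal.ofReal (dist (f.γ θ τ) p)) := by
  obtain ⟨f2, hz, hend, him1, him2⟩ := f.exists_reroute h0 p θ hτ
  set A : Set Ω := {ω | p ∈ f.im ω} with hA
  have hAm : MeasurableSet A := f.measurable_thru p
  set y := f.γ θ τ with hy
  set a := f.mult P p with ha
  have haA : P A = a := rfl
  have hα1 : α - 1 ≤ 0 := by linarith [hα.2]
  -- anti-monotonicity
  have hanti : ∀ {u v : ℝ≥0∞}, u ≤ v → v ^ (α - 1) ≤ u ^ (α - 1) := fun h =>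
    ennreal_rpow_anti hα1 h
  set fs := single (seg_path y p) with hfs
  set S := seg y p '' Icc 0 (dist y p) with hS
  have hSH : μH[1] S ≤ ENNReal.ofReal (dist y p) := by
    refine (haus_image_le (seg_path y p).lip _).trans ?_
    simp
  set Q : Measure Unit := a • Measure.dirac () with hQ
  have haT : a ≠ ⊤ := f.mult_ne_top P p
  have : IsFiniteMeasure Q := by
    constructor
    simp [hQ, haT.lt_top]
  have hms : ∀ x ∈ S, fs.mult Q x = a := by
    intro x hx
    have : {ω : Unit | x ∈ fs.im ω} = univ := by
      ext ω; simp only [mem_ofPred_eq, mem_univ, iff_true]; exact hx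
    rw [Fam.mult, this]
    simp [hQ]
  have hmm : Measurable (f.mult P) := f.measurable_mult P
  have hmsm : Measurable (fs.mult Q) := fs.measurable_mult Q
  set K := a * (a ^ (α - 1) * ENNReal.ofReal (dist y p)) with hK
  have hcomp := concave_compare hα (π₁ := f.occ P + fs.occ Q) (π₂ := f2.occ P)
    (m₁ := f.mult P + fs.mult Q) (m₂ := f2.mult P) (hmm.add hmsm) (f2.measurable_mult P)
    (fun x => ENNReal.add_ne_top.2 ⟨f.mult_ne_top P x, fs.mult_ne_top Q x⟩)
    (f2.mult_ne_top P)
    (by rw [withDensity_add_measure, withDensity_add_left hmm, compat f f2 P P,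
          compat fs f2 Q P])
  -- first term
  have hS1 : ∫⁻ x in S, (f.mult P + fs.mult Q) x ^ (α - 1) ∂μH[1] ≤
      a ^ (α - 1) * ENNReal.ofReal (dist y p) := by
    calc _ ≤ ∫⁻ x in S, a ^ (α - 1) ∂μH[1] := by
          refine setLIntegral_mono measurable_const fun x hx => hanti ?_
          rw [Pi.add_apply, hms x hx]
          exact le_add_self
      _ = a ^ (α - 1) * μH[1] S := by simp
      _ ≤ _ := by gcongr
  have hT1 : ∫⁻ x, (f.mult P + fs.mult Q) x ^ (α - 1) ∂(f.occ P + fs.occ Q) ≤ f.E P α + K := by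
    rw [lintegral_add_measure]
    refine add_le_add (le_trans (lintegral_mono fun x => hanti ?_) (f.F_le_E P α)) ?_
    · exact le_self_add
    · rw [lintegral_occ _ _ ((hmm.add hmsm).pow_const _), hQ, lintegral_smul_measure,
        lintegral_dirac, smul_eq_mul, hK]
      gcongr
      exact hS1
  -- second term
  set tl : Ω → ℝ≥0∞ := fun ω => ∫⁻ t in Icc (f.hit p ω) (f.T ω), f.mult P (f.γ ω t) ^ (α - 1)
    with htl
  have hT2 : ∫⁻ x, (f.mult P + fs.mult Q) x ^ (α - 1) ∂(f2.occ P) ≤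
      (∫⁻ ω in A, tl ω ∂P + ∫⁻ ω in Aᶜ, f.zt P α ω (f.T ω) ∂P) + a * f.zt P α θ τ + K := by
    rw [lintegral_occ _ _ ((hmm.add hmsm).pow_const _), ← lintegral_add_compl _ hAm]
    have hle : ∀ {s : Set (Euc d)}, ∫⁻ x in s, (f.mult P + fs.mult Q) x ^ (α - 1) ∂μH[1] ≤
        ∫⁻ x in s, f.mult P x ^ (α - 1) ∂μH[1] := fun {s} =>
      lintegral_mono fun x => hanti le_self_add
    have b1 : ∫⁻ ω in A, ∫⁻ x in f2.im ω, (f.mult P + fs.mult Q) x ^ (α - 1) ∂μH[1] ∂P ≤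
        ∫⁻ ω in A, (f.zt P α θ τ + a ^ (α - 1) * ENNReal.ofReal (dist y p)) + tl ω ∂P := by
      refine setLIntegral_mono' hAm fun ω hω => ?_
      refine (lintegral_mono_set (him2 ω hω)).trans ?_
      refine (lintegral_union_le _ _ _).trans (add_le_add ?_ ?_)
      · refine (lintegral_union_le _ _ _).trans (add_le_add ?_ hS1)
        exact hle.trans (lintegral_image_le (f.path θ).lip (hmm.pow_const _))
      · exact hle.trans (lintegral_image_le (f.path ω).lip (hmm.pow_const _))
    have b2 : ∫⁻ ω in Aᶜ, ∫⁻ x in f2.im ω, (f.mult P + fs.mult Q) x ^ (α - 1) ∂μH[1] ∂P ≤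
        ∫⁻ ω in Aᶜ, f.zt P α ω (f.T ω) ∂P := by
      refine setLIntegral_mono' hAm.compl fun ω hω => ?_
      rw [him1 ω hω]
      exact hle.trans (f.zt_im_le P α ω)
    refine (add_le_add b1 b2).trans (le_of_eq ?_)
    rw [lintegral_add_left measurable_const, lintegral_const, Measure.restrict_apply_univ, haA, hK]
    ring
  have hopt2 : f.E P α ≤ f2.F P α := by
    refine hopt.trans ?_
    have := f2.irrigationCost_le P hz hα
    simp_rw [hend] at this
    exact this
  -- splitting E
  have hztm : Measurable fun ω => f.zt P α ω (f.hit p ω) :=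
    (f.measurable_zt P α).comp (measurable_id.prodMk
      (f.measurable_hit.comp (measurable_const.prodMk measurable_id)))
  set X := ∫⁻ ω in A, f.zt P α ω (f.hit p ω) ∂P with hX
  set R := ∫⁻ ω in A, tl ω ∂P + ∫⁻ ω in Aᶜ, f.zt P α ω (f.T ω) ∂P with hR
  have hER : f.E P α = X + R := by
    rw [Fam.E, ← lintegral_add_compl _ hAm, hR, ← add_assoc, hX, ← lintegral_add_left hztm]
    congr 1
    refine setLIntegral_congr_fun hAm fun ω hω => ?_
    have := (f.hit_mem hω).1
    exact (f.zt_split P α ω this.1 this.2).symm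
  have hfin := hopt2.trans (hcomp.trans (add_le_add
    (mul_le_mul_right hT1 (ENNReal.ofReal (1 - α))) (mul_le_mul_right hT2 (ENNReal.ofReal α))))
  set Z0 := f.zt P α θ τ
  have hone : ENNReal.ofReal (1 - α) + ENNReal.ofReal α = 1 := by
    rw [← ENNReal.ofReal_add (by linarith [hα.2]) hα.1.le]; simp
  have : f.E P α + ENNReal.ofReal α * X ≤ f.E P α + (ENNReal.ofReal α * (a * Z0) + K) := by
    calc f.E P α + ENNReal.ofReal α * X ≤
        (ENNReal.ofReal (1 - α) * (f.E P α + K) + ENNReal.ofReal α * (R + a * Z0 + K))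
          + ENNReal.ofReal α * X := by gcongr
      _ = ENNReal.ofReal (1 - α) * f.E P α + ENNReal.ofReal α * (X + R) +
          (ENNReal.ofReal α * (a * Z0) + (ENNReal.ofReal (1 - α) + ENNReal.ofReal α) * K) := by ring
      _ = (ENNReal.ofReal (1 - α) + ENNReal.ofReal α) * f.E P α +
          (ENNReal.ofReal α * (a * Z0) + (ENNReal.ofReal (1 - α) + ENNReal.ofReal α) * K) := by
            rw [← hER]; ring
      _ = _ := by rw [hone, one_mul, one_mul]
  exact (ENNReal.add_le_add_iff_left hE).1 this

end Fam
end Reroute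

section Conseq
variable {d : ℕ}

namespace Fam
variable {Ω : Type*} [MeasurableSpace Ω]

lemma zt_mono (f : Fam Ω d) (P : Measure Ω) (α : ℝ) (ω : Ω) {s t : ℝ} (h : s ≤ t) :
    f.zt P α ω s ≤ f.zt P α ω t := lintegral_mono_set (Icc_subset_Icc le_rfl h)

lemma measurable_z (f : Fam Ω d) (P : Measure Ω) [SFinite P] (α : ℝ) :
    Measurable fun ω => f.zt P α ω (f.T ω) :=
  (f.measurable_zt P α).comp (measurable_id.prodMk f.measT)

theorem E_eq_F [StandardBorelSpace Ω] [Nonempty Ω] (f : Fam Ω d) (P : Measure Ω)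
    [IsFiniteMeasure P] (h0 : ∀ ω, f.γ ω 0 = 0) {α : ℝ} (hα : α ∈ Ioo (0 : ℝ) 1)
    (hopt : f.E P α ≤ irrigationCost α (P.map (fun ω => f.γ ω (f.T ω)))) :
    f.E P α = f.F P α :=
  le_antisymm (hopt.trans (f.irrigationCost_le P h0 hα)) (f.F_le_E P α)

theorem ae_first [StandardBorelSpace Ω] [Nonempty Ω] (f : Fam Ω d) (P : Measure Ω)
    [IsFiniteMeasure P] (h0 : ∀ ω, f.γ ω 0 = 0) {α : ℝ} (hα : α ∈ Ioo (0 : ℝ) 1)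
    (hE : f.E P α ≠ ⊤) (hopt : f.E P α ≤ irrigationCost α (P.map (fun ω => f.γ ω (f.T ω)))) :
    ∀ᵐ ω ∂P, f.zt P α ω (f.T ω) ≠ ⊤ ∧
      ∀ᵐ t ∂(volume.restrict (Icc 0 (f.T ω))), t ∈ firstSet (f.γ ω) (f.T ω) ∧
        f.mult P (f.γ ω t) ≠ 0 := by
  have hα1 : α - 1 < 0 := by linarith [hα.2]
  have hEF := f.E_eq_F P h0 hα hopt
  have hfin : ∀ᵐ ω ∂P, f.zt P α ω (f.T ω) < ⊤ := ae_lt_top (f.measurable_z P α) hE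
  have heq : (fun ω => ∫⁻ t in firstSet (f.γ ω) (f.T ω), f.mult P (f.γ ω t) ^ (α - 1) ∂volume)
      =ᵐ[P] fun ω => f.zt P α ω (f.T ω) := by
    refine ae_eq_of_ae_le_of_lintegral_le ?_ ?_ (f.measurable_z P α).aemeasurable ?_
    · exact Eventually.of_forall fun ω => lintegral_mono_set firstSet_subset
    · rw [← F_eq, ← hEF]; exact hE
    · rw [← F_eq, ← hEF]; exact le_rfl
  filter_upwards [hfin, heq] with ω h1 h2
  have hφ : Measurable fun t => f.mult P (f.γ ω t) ^ (α - 1) :=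
    ((f.measurable_mult P).comp (f.cont ω).measurable).pow_const _
  refine ⟨h1.ne, ?_⟩
  have hfm := (f.path ω).measurableSet_first
  have e1 : ∀ᵐ t ∂(volume.restrict (Icc 0 (f.T ω))), f.mult P (f.γ ω t) ^ (α - 1) < ⊤ :=
    ae_lt_top hφ h1.ne
  have hsplit : f.zt P α ω (f.T ω) =
      ∫⁻ t in firstSet (f.γ ω) (f.T ω), f.mult P (f.γ ω t) ^ (α - 1) ∂volume +
      ∫⁻ t in Icc 0 (f.T ω) \ firstSet (f.γ ω) (f.T ω), f.mult P (f.γ ω t) ^ (α - 1) ∂volume := by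
    rw [← lintegral_union (measurableSet_Icc.diff hfm) disjoint_sdiff_right,
      union_sdiff_cancel firstSet_subset, zt]
  have e2 : ∫⁻ t in Icc 0 (f.T ω) \ firstSet (f.γ ω) (f.T ω), f.mult P (f.γ ω t) ^ (α - 1) ∂volume
      = 0 := by
    rw [h2] at hsplit
    nth_rewrite 1 [← add_zero (f.zt P α ω (f.T ω))] at hsplit
    exact ((ENNReal.add_right_inj h1.ne).1 hsplit).symm
  rw [lintegral_eq_zero_iff hφ] at e2
  have e3 := (ae_restrict_iff' (measurableSet_Icc.diff hfm)).1 e2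
  have e4 := ae_restrict_of_ae (s := Icc 0 (f.T ω)) e3
  filter_upwards [e1, e4, ae_restrict_mem measurableSet_Icc] with t h5 h6 h7
  constructor
  · by_contra hne
    have := h6 ⟨h7, hne⟩
    simp only [Pi.zero_apply, ENNReal.rpow_eq_zero_iff] at this
    rcases this with h | h
    · linarith [h.2]
    · exact f.mult_ne_top P _ h.1
  · intro h
    rw [h, ENNReal.zero_rpow_of_neg hα1] at h5
    exact lt_irrefl _ h5

theorem key_ineq [StandardBorelSpace Ω] [Nonempty Ω] (f : Fam Ω d) (P : Measure Ω)
    [IsFiniteMeasure P] (h0 : ∀ ω, f.γ ω 0 = 0) {α : ℝ} (hα : α ∈ Ioo (0 : ℝ) 1)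
    (hE : f.E P α ≠ ⊤) (hopt : f.E P α ≤ irrigationCost α (P.map (fun ω => f.γ ω (f.T ω)))) :
    ∀ᵐ ω ∂P, ∀ᵐ t ∂(volume.restrict (Icc 0 (f.T ω))), ∀ θ, ∀ τ ∈ Icc 0 (f.T θ),
      ENNReal.ofReal α * f.zt P α ω t ≤ ENNReal.ofReal α * f.zt P α θ τ +
        f.mult P (f.γ ω t) ^ (α - 1) * ENNReal.ofReal (dist (f.γ θ τ) (f.γ ω t)) := by
  have hαe : ENNReal.ofReal α ≠ 0 := by simpa using hα.1
  -- Hs and B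
  set Hs : Euc d → Ω → ℝ≥0∞ := fun x ω => f.zt P α ω (f.hit x ω) with hHs
  have hHm : Measurable fun q : Euc d × Ω => Hs q.1 q.2 :=
    (f.measurable_zt P α).comp (measurable_snd.prodMk f.measurable_hit)
  have hHm1 : ∀ x, Measurable (Hs x) := fun x => by
    exact Measurable.of_uncurry_left (f := Hs) hHm
  set B : Euc d → ℝ≥0∞ := fun x => ∫⁻ ω in {ω | x ∈ f.im ω}, Hs x ω ∂P with hB
  have hAm : MeasurableSet {q : Euc d × Ω | q.1 ∈ f.im q.2} := by
    have h := (measurable_snd.prodMk measurable_fst : Measurable fun q : Euc d × Ω => (q.2, q.1)) f.measurable_im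
    exact h
  have hBm : Measurable B := by
    have : B = fun x => ∫⁻ ω, {q : Euc d × Ω | q.1 ∈ f.im q.2}.indicator
        (fun q => Hs q.1 q.2) (x, ω) ∂P := by
      ext1 x
      simp only [hB]
      rw [← lintegral_indicator (f.measurable_thru x)]
      rfl
    rw [this]
    exact Measurable.lintegral_prod_right' (f := {q : Euc d × Ω | q.1 ∈ f.im q.2}.indicator
        (fun q => Hs q.1 q.2)) (hHm.indicator hAm)
  have hBfin : ∀ x, B x ≠ ⊤ := by
    intro x
    refine ne_top_of_le_ne_top hE ?_
    refine le_trans ?_ (setLIntegral_le_lintegral {ω | x ∈ f.im ω} _)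
    exact setLIntegral_mono' (f.measurable_thru x) fun ω hω =>
      f.zt_mono P α ω (f.hit_mem hω).1.2
  have hBle : ∀ x ω, x ∈ f.im ω → B x ≤ f.mult P x * Hs x ω := by
    intro x ω hx
    have hh := f.hit_mem hx
    have := f.reroute P h0 hα hE hopt x ω hh.1
    rw [hh.2, dist_self, ENNReal.ofReal_zero, mul_zero, mul_zero, add_zero] at this
    exact (ENNReal.mul_le_mul_iff_right hαe ENNReal.ofReal_ne_top).1 this
  have hBeq : ∀ x, ∀ᵐ ω ∂(P.restrict {ω | x ∈ f.im ω}), B x = f.mult P x * Hs x ω := by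
    intro x
    refine ae_eq_of_ae_le_of_lintegral_le (f := fun _ => B x) ?_ ?_
      ((hHm1 x).const_mul _).aemeasurable ?_
    · filter_upwards [ae_restrict_mem (f.measurable_thru x)] with ω hω
      exact hBle x ω hω
    · rw [lintegral_const, Measure.restrict_apply_univ]
      exact ENNReal.mul_ne_top (hBfin x) (f.mult_ne_top P x)
    · rw [lintegral_const, Measure.restrict_apply_univ, lintegral_const_mul _ (hHm1 x), mul_comm]
      exact le_rfl
  set D : Set (Euc d × Ω) := {q | B q.1 = f.mult P q.1 * Hs q.1 q.2} with hD
  have hDm : MeasurableSet D :=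
    measurableSet_eq_fun (hBm.comp measurable_fst)
      (((f.measurable_mult P).comp measurable_fst).mul hHm)
  set ψ : Euc d × Ω → ℝ≥0∞ := Dᶜ.indicator fun _ => 1 with hψ
  have hψm : Measurable ψ := measurable_const.indicator hDm.compl
  have hsw := swap_general f f P P (φ := fun _ ω' x => ψ (x, ω'))
    (hψm.comp ((measurable_snd.comp measurable_snd).prodMk (measurable_fst.comp measurable_snd)))
  have hzero : ∀ x, ∫⁻ ω' in {ω' | x ∈ f.im ω'}, ψ (x, ω') ∂P = 0 := by
    intro x
    have hm : Measurable fun ω' => ψ (x, ω') :=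
      hψm.comp (measurable_const.prodMk measurable_id)
    rw [lintegral_eq_zero_iff hm]
    filter_upwards [hBeq x] with ω hω
    have : (x, ω) ∈ D := hω
    simp [hψ, this]
  simp_rw [hzero] at hsw
  simp only [lintegral_zero, lintegral_const, Measure.restrict_apply_univ] at hsw
  have hmeas2 : Measurable fun ω => ∫⁻ x in f.im ω, ψ (x, ω) * P {ω' | x ∈ f.im ω'} ∂μH[1] := by
    have := (f.measurable_path_integral (Y := Unit)
      (φ := fun _ ω x => ψ (x, ω) * f.mult P x) ?_).comp
      ((measurable_const (a := ())).prodMk measurable_id)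
    · exact this
    · exact (hψm.comp ((measurable_snd.comp measurable_snd).prodMk
        (measurable_fst.comp measurable_snd))).mul
        ((f.measurable_mult P).comp (measurable_snd.comp measurable_snd))
  have hsw2 := (lintegral_eq_zero_iff hmeas2).1 hsw.symm
  filter_upwards [hsw2, f.ae_first P h0 hα hE hopt] with ω h1 h2
  have hφ : Measurable fun x => ψ (x, ω) * f.mult P x :=
    (hψm.comp (measurable_id.prodMk measurable_const)).mul (f.measurable_mult P)
  have h3 : ∫⁻ t in firstSet (f.γ ω) (f.T ω), ψ (f.γ ω t, ω) * f.mult P (f.γ ω t) ∂volume = 0 := by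
    rw [← (f.path ω).lintegral_im hφ]
    exact h1
  have hm3 : Measurable fun t => ψ (f.γ ω t, ω) * f.mult P (f.γ ω t) :=
    hφ.comp (f.cont ω).measurable
  rw [lintegral_eq_zero_iff hm3] at h3
  have h4 := ae_restrict_of_ae (s := Icc 0 (f.T ω))
    ((ae_restrict_iff' (f.path ω).measurableSet_first).1 h3)
  filter_upwards [h4, h2.2] with t h5 h6 θ τ hτ
  have h7 := h5 h6.1
  simp only [Pi.zero_apply, mul_eq_zero] at h7
  have h8 : (f.γ ω t, ω) ∈ D := by
    rcases h7 with h | h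
    · by_contra hne
      simp [hψ, hne] at h
    · exact absurd h h6.2
  have h9 : B (f.γ ω t) = f.mult P (f.γ ω t) * f.zt P α ω t := by
    have : B (f.γ ω t) = f.mult P (f.γ ω t) * Hs (f.γ ω t) ω := h8
    rw [this, hHs]
    simp only [f.hit_first h6.1]
  have h10 := f.reroute P h0 hα hE hopt (f.γ ω t) θ hτ
  have h11 : ∫⁻ ω' in {ω' | f.γ ω t ∈ f.im ω'}, f.zt P α ω' (f.hit (f.γ ω t) ω') ∂P =
      B (f.γ ω t) := rfl
  rw [h11, h9] at h10
  have h12 : f.mult P (f.γ ω t) * (ENNReal.ofReal α * f.zt P α ω t) ≤ f.mult P (f.γ ω t) *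
      (ENNReal.ofReal α * f.zt P α θ τ +
        f.mult P (f.γ ω t) ^ (α - 1) * ENNReal.ofReal (dist (f.γ θ τ) (f.γ ω t))) := by
    calc _ = _ := by ring
      _ ≤ _ := h10
      _ = _ := by ring
  exact (ENNReal.mul_le_mul_iff_right h6.2 (f.mult_ne_top P _)).1 h12

end Fam
end Conseq

section FamOf
variable {d : ℕ} {μ : Measure (Euc d)}

lemma IsPath.le_iff {c : ℝ → Euc d} {T : ℝ} (h : IsPath c T) {a : ℝ} (ha : 0 ≤ a) :
    T ≤ a ↔ ∀ q : ℚ, a ≤ q → c q = c a := by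
  constructor
  · intro hT q hq
    rw [h.halts _ (hT.trans hq), h.halts a hT]
  · intro hq
    by_contra hlt
    rw [not_le] at hlt
    have hcont := h.lip.continuous
    have hall : ∀ t ∈ Ioi a, c t = c a := by
      intro t ht
      by_contra hne
      have hopen : IsOpen {s | c s ≠ c a} := isOpen_ne_fun hcont continuous_const
      have hopen2 := hopen.inter (isOpen_Ioi (a := a))
      obtain ⟨q, hq1⟩ := Rat.denseRange_cast (𝕜 := ℝ) |>.exists_mem_open hopen2 ⟨t, hne, ht⟩
      exact hq1.1 (hq q (le_of_lt hq1.2))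
    have hsp := ae_Icc_iff_Ioo.1 h.speed
    have hpos : (volume : Measure ℝ) (Ioo a T) ≠ 0 := by
      rw [Real.volume_Ioo]
      simpa using hlt
    obtain ⟨t, ht1, ht2⟩ : ∃ t, t ∈ Ioo a T ∧ (t ∈ Ioo 0 T → ‖deriv c t‖ = 1) := by
      by_contra hcon
      push Not at hcon
      apply hpos
      refine measure_mono_null (fun t ht => ?_) (ae_iff.1 hsp)
      intro hh
      exact (hcon t ht).2 (hh (hcon t ht).1)
    have e : c =ᶠ[𝓝 t] fun _ => c a := by
      filter_upwards [Ioi_mem_nhds ht1.1] with s hs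
      exact hall s hs
    have := ht2 ⟨ha.trans_lt ht1.1, ht1.2⟩
    rw [e.deriv_eq] at this
    simp at this

namespace IrrigationPlan

lemma isPath (χ : IrrigationPlan μ) {θ : ℝ} (h : θ ∈ Icc (0 : ℝ) (μ univ).toReal) :
    IsPath (χ.toFun θ) (χ.T θ) :=
  ⟨χ.T_nonneg θ, χ.lipschitz θ h, χ.unit_speed θ h, χ.stopped θ h⟩

open Classical in
/-- the plan as a family -/
def fam (χ : IrrigationPlan μ) : Fam ℝ d where
  γ θ := if θ ∈ Icc (0 : ℝ) (μ univ).toReal then χ.toFun θ else fun _ => 0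
  T θ := if θ ∈ Icc (0 : ℝ) (μ univ).toReal then χ.T θ else 0
  meas := by
    have : (Function.uncurry fun θ => if θ ∈ Icc (0 : ℝ) (μ univ).toReal then χ.toFun θ
        else fun _ => (0 : Euc d)) = fun q : ℝ × ℝ => if q.1 ∈ Icc (0 : ℝ) (μ univ).toReal then
          Function.uncurry χ.toFun q else 0 := by
      ext1 q
      simp only [Function.uncurry]
      split_ifs <;> rfl
    rw [this]
    exact Measurable.ite (measurable_fst measurableSet_Icc) χ.measurable measurable_const
  measT := by
    have key : ∀ a : ℝ, 0 ≤ a → MeasurableSet {θ : ℝ | θ ∈ Icc (0 : ℝ) (μ univ).toReal ∧ χ.T θ ≤ a} := by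
      intro a ha
      have : {θ : ℝ | θ ∈ Icc (0 : ℝ) (μ univ).toReal ∧ χ.T θ ≤ a} =
          Icc (0 : ℝ) (μ univ).toReal ∩ ⋂ q : ℚ, {θ | a ≤ q → χ.toFun θ q = χ.toFun θ a} := by
        ext θ
        simp only [mem_ofPred_eq, mem_inter_iff, mem_iInter]
        exact and_congr_right fun h => (χ.isPath h).le_iff ha
      rw [this]
      refine measurableSet_Icc.inter (MeasurableSet.iInter fun q => ?_)
      have hm : ∀ s : ℝ, Measurable fun θ => χ.toFun θ s := fun s =>
        χ.measurable.comp (measurable_id.prodMk measurable_const)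
      by_cases haq : a ≤ q
      · simp only [haq, true_imp_iff]
        exact measurableSet_eq_fun (hm _) (hm _)
      · simp [haq]
    refine measurable_of_Iic fun a => ?_
    rcases lt_or_ge a 0 with ha | ha
    · convert MeasurableSet.empty
      ext θ
      simp only [mem_preimage, mem_Iic, mem_empty_iff_false, iff_false, not_le]
      split_ifs
      · exact ha.trans_le (χ.T_nonneg θ)
      · exact ha
    · convert (key a ha).union measurableSet_Icc.compl (s₂ := (Icc (0 : ℝ) (μ univ).toReal)ᶜ)
      ext θ
      by_cases h : θ ∈ Icc (0 : ℝ) (μ univ).toReal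
      · simp only [mem_preimage, mem_Iic, mem_union, mem_ofPred_eq, mem_compl_iff]
        rw [if_pos h]; tauto
      · simp only [mem_preimage, mem_Iic, mem_union, mem_ofPred_eq, mem_compl_iff]
        rw [if_neg h]; tauto
  path θ := by
    split_ifs with h
    · exact χ.isPath h
    · exact IsPath.const 0

/-- the parameter measure -/
def par (_ : IrrigationPlan μ) : Measure ℝ := volume.restrict (Icc (0 : ℝ) (μ univ).toReal)

instance (χ : IrrigationPlan μ) : IsFiniteMeasure χ.par := by
  unfold par; infer_instance

variable (χ : IrrigationPlan μ)

lemma fam_γ {θ : ℝ} (h : θ ∈ Icc (0 : ℝ) (μ univ).toReal) : χ.fam.γ θ = χ.toFun θ := if_pos h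
lemma fam_T {θ : ℝ} (h : θ ∈ Icc (0 : ℝ) (μ univ).toReal) : χ.fam.T θ = χ.T θ := if_pos h

lemma fam_zero (θ : ℝ) : χ.fam.γ θ 0 = 0 := by
  by_cases h : θ ∈ Icc (0 : ℝ) (μ univ).toReal
  · rw [χ.fam_γ h, χ.start θ h]
  · have : χ.fam.γ θ = fun _ => 0 := if_neg h
    rw [this]

lemma ae_par : ∀ᵐ θ ∂χ.par, θ ∈ Icc (0 : ℝ) (μ univ).toReal := ae_restrict_mem measurableSet_Icc

lemma fam_mult (x : Euc d) : χ.fam.mult χ.par x = χ.mult x := by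
  unfold mult Fam.mult par
  rw [Measure.restrict_apply (χ.fam.measurable_thru x)]
  congr 1
  ext θ
  simp only [mem_inter_iff, mem_ofPred_eq]
  rw [and_comm]
  refine and_congr_right fun h => ?_
  rw [(χ.isPath h).exists_nonneg, Fam.im, χ.fam_γ h, χ.fam_T h]

lemma fam_end : χ.par.map (fun θ => χ.fam.γ θ (χ.fam.T θ)) = μ := by
  conv_rhs => rw [← χ.irrigates]
  refine Measure.map_congr ?_
  filter_upwards [χ.ae_par] with θ h
  rw [χ.fam_γ h, χ.fam_T h]

lemma fam_cost (α : ℝ) : χ.cost α = χ.fam.E χ.par α := by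
  unfold cost Fam.E
  refine lintegral_congr_ae ?_
  filter_upwards [χ.ae_par] with θ h
  rw [(χ.isPath h).cost_inner (fun t => χ.mult (χ.toFun θ t) ^ (α - 1)), Fam.zt,
    χ.fam_γ h, χ.fam_T h]
  simp_rw [fam_mult]

lemma zt_eq (α : ℝ) {θ : ℝ} (h : θ ∈ Icc (0 : ℝ) (μ univ).toReal) (τ : ℝ) :
    χ.fam.zt χ.par α θ τ = ∫⁻ t in Icc (0 : ℝ) τ, χ.mult (χ.toFun θ t) ^ (α - 1) := by
  rw [Fam.zt, χ.fam_γ h]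
  simp_rw [fam_mult]

lemma Zchi_le (α : ℝ) {θ : ℝ} (h : θ ∈ Icc (0 : ℝ) (μ univ).toReal) {τ : ℝ} (hτ : 0 ≤ τ) :
    χ.Zchi α (χ.fam.γ θ τ) ≤ χ.fam.zt χ.par α θ τ := by
  rw [χ.zt_eq α h, χ.fam_γ h]
  unfold Zchi
  exact (iInf₂_le θ h).trans ((iInf₂_le τ hτ).trans (iInf_le _ rfl))

lemma le_Zchi (α : ℝ) {x : Euc d} {a : ℝ≥0∞}
    (h : ∀ θ, ∀ τ ∈ Icc 0 (χ.fam.T θ), χ.fam.γ θ τ = x → a ≤ χ.fam.zt χ.par α θ τ) :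
    a ≤ χ.Zchi α x := by
  unfold Zchi
  refine le_iInf₂ fun θ hθ => le_iInf₂ fun τ hτ => le_iInf fun hx => ?_
  rw [← χ.zt_eq α hθ]
  rcases le_total τ (χ.fam.T θ) with h1 | h1
  · exact h θ τ ⟨hτ, h1⟩ (by rw [χ.fam_γ hθ, hx])
  · refine (h θ (χ.fam.T θ) ⟨(χ.fam.path θ).T0, le_rfl⟩ ?_).trans (χ.fam.zt_mono _ _ _ h1)
    rw [← (χ.fam.path θ).halts τ h1, χ.fam_γ hθ, hx]

end IrrigationPlan
end FamOf

section Land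
variable {d : ℕ} {μ : Measure (Euc d)}

lemma exists_good {T a b : ℝ} {p : ℝ → Prop} (h : ∀ᵐ t ∂(volume.restrict (Icc (0 : ℝ) T)), p t)
    (ha : 0 ≤ a) (hab : a < b) (hb : b ≤ T) : ∃ t ∈ Ioo a b, p t := by
  have hsp := ae_Icc_iff_Ioo.1 h
  have hpos : (volume : Measure ℝ) (Ioo a b) ≠ 0 := by
    rw [Real.volume_Ioo]
    simpa using hab
  by_contra hcon
  push Not at hcon
  apply hpos
  refine measure_mono_null (fun t ht => ?_) (ae_iff.1 hsp)
  intro hh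
  exact hcon t ht (hh ⟨ha.trans_lt ht.1, ht.2.trans_le hb⟩)

lemma exists_small {φ : ℝ → ℝ≥0∞} (hφ : Measurable φ) {T t₀ : ℝ} {p : ℝ → Prop}
    (h : ∀ᵐ t ∂(volume.restrict (Icc (0 : ℝ) T)), p t) (h0 : 0 ≤ t₀) (hT : t₀ < T)
    {η : ℝ≥0∞} (hη0 : η ≠ 0) (hη : η ≠ ⊤) (hint : ∫⁻ t in Icc t₀ T, φ t ≤ η) :
    ∃ t ∈ Ioo t₀ T, p t ∧ φ t * ENNReal.ofReal (T - t₀) ≤ 4 * η := by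
  by_contra hcon
  push Not at hcon
  set r := ENNReal.ofReal ((T - t₀) / 2) with hr
  have hr0 : r ≠ 0 := by simp [hr, hT]
  have hrt : r ≠ ⊤ := ENNReal.ofReal_ne_top
  have hD : ENNReal.ofReal (T - t₀) = 2 * r := by
    rw [hr, ← ENNReal.ofReal_ofNat, ← ENNReal.ofReal_mul (by norm_num)]
    congr 1; ring
  have hsp := ae_Icc_iff_Ioo.1 h
  have hle : ∫⁻ _ in Ioo t₀ T, 4 * η ≤ ∫⁻ t in Ioo t₀ T, φ t * ENNReal.ofReal (T - t₀) := by
    refine lintegral_mono_ae ?_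
    filter_upwards [ae_restrict_of_ae hsp, ae_restrict_mem measurableSet_Ioo] with t h1 h2
    exact (hcon t h2 (h1 ⟨h0.trans_lt h2.1, h2.2⟩)).le
  rw [lintegral_const, Measure.restrict_apply_univ, Real.volume_Ioo, lintegral_mul_const _ hφ] at hle
  have h2 : ∫⁻ t in Ioo t₀ T, φ t ≤ η := (lintegral_mono_set Ioo_subset_Icc_self).trans hint
  have h3 : 4 * (η * ENNReal.ofReal (T - t₀)) ≤ 1 * (η * ENNReal.ofReal (T - t₀)) := by
    rw [one_mul, ← mul_assoc]
    exact hle.trans (mul_le_mul_left h2 _)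
  have hne : η * ENNReal.ofReal (T - t₀) ≠ 0 := by
    rw [hD]; exact mul_ne_zero hη0 (mul_ne_zero two_ne_zero hr0)
  have h4 := (ENNReal.mul_le_mul_iff_left hne (ENNReal.mul_ne_top hη ENNReal.ofReal_ne_top)).1 h3
  norm_num at h4

lemma exists_tail {φ : ℝ → ℝ≥0∞} {T : ℝ} (hT : 0 < T) (hfin : ∫⁻ t in Icc 0 T, φ t ≠ ⊤)
    {η : ℝ≥0∞} (hη0 : η ≠ 0) : ∃ t₀, 0 ≤ t₀ ∧ t₀ < T ∧ ∫⁻ t in Icc t₀ T, φ t ≤ η := by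
  obtain ⟨δ, hδ, h⟩ := exists_pos_setLIntegral_lt_of_measure_lt hfin hη0
  obtain ⟨e, he0, he⟩ : ∃ e : ℝ, 0 < e ∧ ENNReal.ofReal e < δ := by
    rcases eq_or_ne δ ⊤ with rfl | ht
    · exact ⟨1, one_pos, ENNReal.ofReal_lt_top⟩
    · refine ⟨δ.toReal / 2, half_pos (ENNReal.toReal_pos hδ.ne' ht), ?_⟩
      rw [ENNReal.ofReal_lt_iff_lt_toReal (by positivity) ht]
      exact half_lt_self (ENNReal.toReal_pos hδ.ne' ht)
  refine ⟨max 0 (T - e), le_max_left _ _, max_lt hT (by linarith), ?_⟩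
  have := h (Icc (max 0 (T - e)) T) ?_
  · rw [Measure.restrict_restrict measurableSet_Icc, inter_eq_left.2
      (Icc_subset_Icc (le_max_left _ _) le_rfl)] at this
    exact this.le
  · refine (Measure.restrict_apply_le _ _).trans_lt ?_
    rw [Real.volume_Icc]
    refine (ENNReal.ofReal_le_ofReal ?_).trans_lt he
    linarith [le_max_right 0 (T - e)]

namespace Fam
variable {Ω : Type*} [MeasurableSpace Ω]

lemma lower (f : Fam Ω d) (P : Measure Ω) [IsFiniteMeasure P] {α : ℝ} (hα : α ∈ Ioo (0 : ℝ) 1)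
    {ω : Ω} (hfin : f.zt P α ω (f.T ω) ≠ ⊤)
    (hk : ∀ᵐ t ∂(volume.restrict (Icc 0 (f.T ω))), ∀ θ, ∀ τ ∈ Icc 0 (f.T θ),
      ENNReal.ofReal α * f.zt P α ω t ≤ ENNReal.ofReal α * f.zt P α θ τ +
        f.mult P (f.γ ω t) ^ (α - 1) * ENNReal.ofReal (dist (f.γ θ τ) (f.γ ω t)))
    {c : ℝ≥0∞} (hc : c < f.zt P α ω (f.T ω)) :
    ∃ r > 0, ∀ θ, ∀ τ ∈ Icc 0 (f.T θ), dist (f.γ θ τ) (f.γ ω (f.T ω)) < r →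
      c ≤ f.zt P α θ τ := by
  set T := f.T ω with hTd
  have hT : 0 < T := by
    rcases (f.path ω).T0.lt_or_eq with h | h
    · exact h
    · exfalso
      rw [hTd, ← h, zt] at hc
      simp at hc
  have hαe : ENNReal.ofReal α ≠ 0 := by simpa using hα.1
  set z := f.zt P α ω T with hz
  set δ := z - c with hδ
  have hδ0 : δ ≠ 0 := (tsub_pos_of_lt hc).ne'
  have hδt : δ ≠ ⊤ := ne_top_of_le_ne_top hfin tsub_le_self
  set η := ENNReal.ofReal α * δ / 9 with hη
  have hη9 : 9 * η = ENNReal.ofReal α * δ := by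
    rw [hη, ENNReal.mul_div_cancel (by norm_num) (by norm_num)]
  have hη0 : η ≠ 0 := by
    rw [hη]; exact ENNReal.div_ne_zero.2 ⟨mul_ne_zero hαe hδ0, by norm_num⟩
  have hηt : η ≠ ⊤ := ENNReal.div_ne_top (ENNReal.mul_ne_top ENNReal.ofReal_ne_top hδt) (by norm_num)
  have hφ : Measurable fun t => f.mult P (f.γ ω t) ^ (α - 1) :=
    ((f.measurable_mult P).comp (f.cont ω).measurable).pow_const _
  obtain ⟨t₀, h0, h1, h2⟩ := exists_tail hT hfin hη0
  obtain ⟨t, ht, hp, hs⟩ := exists_small hφ hk h0 h1 hη0 hηt h2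
  refine ⟨T - t₀, by linarith, fun θ τ hτ hd => ?_⟩
  have hd2 : dist (f.γ θ τ) (f.γ ω t) ≤ 2 * (T - t₀) := by
    have e1 := dist_triangle (f.γ θ τ) (f.γ ω T) (f.γ ω t)
    have e2 := (f.path ω).lip.dist_le_mul T t
    rw [Real.dist_eq, abs_of_nonneg (by linarith [ht.2])] at e2
    simp only [NNReal.coe_one, one_mul] at e2
    linarith [ht.1]
  have h3 : ENNReal.ofReal α * f.zt P α ω t ≤ ENNReal.ofReal α * f.zt P α θ τ + 8 * η := by
    refine (hp θ τ hτ).trans (add_le_add le_rfl ?_)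
    calc _ ≤ f.mult P (f.γ ω t) ^ (α - 1) * ENNReal.ofReal (2 * (T - t₀)) := by gcongr
      _ = 2 * (f.mult P (f.γ ω t) ^ (α - 1) * ENNReal.ofReal (T - t₀)) := by
        rw [ENNReal.ofReal_mul (by norm_num), ENNReal.ofReal_ofNat]; ring
      _ ≤ 2 * (4 * η) := by gcongr
      _ = 8 * η := by ring
  have h4 := f.zt_split P α ω (h0.trans ht.1.le) ht.2.le
  have h5 : z ≤ f.zt P α ω t + η := by
    rw [hz, ← h4]
    exact add_le_add le_rfl ((lintegral_mono_set (Icc_subset_Icc ht.1.le le_rfl)).trans h2)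
  have hα1 : ENNReal.ofReal α ≤ 1 := by
    rw [← ENNReal.ofReal_one]; exact ENNReal.ofReal_le_ofReal hα.2.le
  have h6 : ENNReal.ofReal α * c + 9 * η ≤ ENNReal.ofReal α * f.zt P α θ τ + 9 * η := by
    calc ENNReal.ofReal α * c + 9 * η = ENNReal.ofReal α * z := by
          rw [hη9, ← mul_add, hδ, add_tsub_cancel_of_le hc.le]
      _ ≤ ENNReal.ofReal α * (f.zt P α ω t + η) := by gcongr
      _ = ENNReal.ofReal α * f.zt P α ω t + ENNReal.ofReal α * η := by ring
      _ ≤ (ENNReal.ofReal α * f.zt P α θ τ + 8 * η) + 1 * η := by gcongr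
      _ = _ := by ring
  have h7 := (ENNReal.add_le_add_iff_right (ENNReal.mul_ne_top (by norm_num) hηt)).1 h6
  exact (ENNReal.mul_le_mul_iff_right hαe ENNReal.ofReal_ne_top).1 h7

end Fam

namespace IrrigationPlan
variable (χ : IrrigationPlan μ)

theorem landscape_end {α : ℝ} (hα : α ∈ Ioo (0 : ℝ) 1) (hE : χ.fam.E χ.par α ≠ ⊤)
    (hopt : χ.fam.E χ.par α ≤ irrigationCost α μ) :
    ∀ᵐ θ ∂χ.par, χ.landscape α (χ.fam.γ θ (χ.fam.T θ)) = χ.fam.zt χ.par α θ (χ.fam.T θ) := by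
  rcases eq_or_ne χ.par 0 with hP | hP
  · rw [hP]; simp
  have hopt' : χ.fam.E χ.par α ≤
      irrigationCost α (χ.par.map (fun ω => χ.fam.γ ω (χ.fam.T ω))) := by
    rwa [fam_end]
  filter_upwards [χ.fam.key_ineq χ.par χ.fam_zero hα hE hopt',
    χ.fam.ae_first χ.par χ.fam_zero hα hE hopt', χ.ae_par] with ω hk hf hω
  unfold landscape
  refine le_antisymm ?_ ?_
  · refine liminf_le_of_frequently_le' ?_
    rw [frequently_nhdsWithin_iff, frequently_iff]
    intro U hU
    rcases (χ.fam.path ω).T0.lt_or_eq with hT | hT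
    · have hc := (χ.fam.cont ω).continuousAt (x := χ.fam.T ω) hU
      obtain ⟨e, he, hb⟩ := Metric.mem_nhds_iff.1 hc
      obtain ⟨t, ht, h1⟩ := exists_good hf.2 (a := max 0 (χ.fam.T ω - e)) (le_max_left _ _)
        (max_lt hT (by linarith)) le_rfl
      have h2 := (max_lt_iff.1 ht.1)
      refine ⟨χ.fam.γ ω t, hb ?_, ?_, ?_⟩
      · rw [Metric.mem_ball, Real.dist_eq, abs_lt]
        constructor <;> linarith [ht.2]
      · exact (χ.Zchi_le α hω h2.1.le).trans (χ.fam.zt_mono _ _ _ ht.2.le)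
      · change 0 < χ.mult _
        rw [← fam_mult]
        exact pos_iff_ne_zero.2 h1.2
    · rw [← hT] at hU ⊢
      refine ⟨χ.fam.γ ω 0, mem_of_mem_nhds hU, χ.Zchi_le α hω le_rfl, ?_⟩
      change 0 < χ.mult _
      rw [← fam_mult, Fam.mult, fam_zero]
      have : {θ | (0 : Euc d) ∈ χ.fam.im θ} = univ := by
        ext θ
        simp only [mem_ofPred_eq, mem_univ, iff_true]
        exact ⟨0, ⟨le_rfl, (χ.fam.path θ).T0⟩, χ.fam_zero θ⟩
      rw [this]
      exact Measure.measure_univ_pos.2 hP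
  · refine le_of_forall_lt fun c hc => ?_
    obtain ⟨c', hc', hc''⟩ := exists_between hc
    refine hc'.trans_le ?_
    obtain ⟨r, hr, h⟩ := χ.fam.lower χ.par hα hf.1 hk hc''
    refine le_liminf_of_le (by isBoundedDefault) ?_
    refine mem_nhdsWithin_of_mem_nhds ?_
    filter_upwards [Metric.ball_mem_nhds _ hr] with y hy
    refine χ.le_Zchi α fun θ τ hτ hxy => h θ τ hτ ?_
    rw [hxy]; exact hy

lemma measurable_landscape (α : ℝ) : Measurable (χ.landscape α) := by
  refine measurable_of_Ioi fun c => IsOpen.measurableSet ?_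
  rw [isOpen_iff_mem_nhds]
  intro x hx
  simp only [mem_preimage, mem_Ioi, landscape] at hx
  obtain ⟨c', h1, h2⟩ := exists_between hx
  have h3 := eventually_lt_of_lt_liminf h2
  have h4 := eventually_nhdsWithin_iff.1 h3
  filter_upwards [eventually_eventually_nhds.2 h4] with y hy
  simp only [mem_preimage, mem_Ioi, landscape]
  refine h1.trans_le (le_liminf_of_le (by isBoundedDefault) ?_)
  exact eventually_nhdsWithin_iff.2 (hy.mono fun z hz hz' => (hz hz').le)

end IrrigationPlan
end Land

lemma map_withDensity_comp {Ω : Type*} [MeasurableSpace Ω] {d : ℕ} (P : Measure Ω)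
    {e : Ω → Euc d} (he : Measurable e) {ρ : Euc d → ℝ≥0∞} (hρ : Measurable ρ) :
    (P.withDensity fun ω => ρ (e ω)).map e = (P.map e).withDensity ρ := by
  ext s hs
  rw [Measure.map_apply he hs, withDensity_apply _ (he hs), withDensity_apply _ hs,
    setLIntegral_map hs hρ he]

lemma lintegral_end {d : ℕ} {μ : Measure (Euc d)} (χ : IrrigationPlan μ) {φ : Euc d → ℝ≥0∞}
    (hφ : Measurable φ) :
    ∫⁻ x, φ x ∂μ = ∫⁻ ω, φ (χ.fam.γ ω (χ.fam.T ω)) ∂χ.par := by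
  conv_lhs => rw [← χ.fam_end]
  rw [lintegral_map hφ χ.fam.measurable_end]

theorem perturb_aux {d : ℕ} (α : ℝ) (hα : α ∈ Ioo (0 : ℝ) 1)
    (μ : Measure (Euc d)) (χ : IrrigationPlan μ) (hE : χ.fam.E χ.par α ≠ ⊤)
    (hopt : χ.fam.E χ.par α ≤ irrigationCost α μ)
    (ρ : Euc d → ℝ≥0∞) (hρ : Measurable ρ) (hfin : ∫⁻ x, ρ x ∂μ ≠ ⊤) :
    irrigationCost α (μ.withDensity ρ) ≤ ENNReal.ofReal (1 - α) * χ.fam.E χ.par α +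
      ENNReal.ofReal α * ∫⁻ x, ρ x * χ.landscape α x ∂μ := by
  set f := χ.fam with hf
  set P := χ.par with hP
  have he := f.measurable_end
  have hρe : Measurable fun ω => ρ (f.γ ω (f.T ω)) := hρ.comp he
  have hmap := χ.fam_end
  set P' : Measure ℝ := P.withDensity fun ω => ρ (f.γ ω (f.T ω)) with hP'
  have hP'fin : IsFiniteMeasure P' := by
    refine isFiniteMeasure_withDensity ?_
    rw [← lintegral_map hρ he, hmap]
    exact hfin
  have hend : P'.map (fun ω => f.γ ω (f.T ω)) = μ.withDensity ρ := by
    rw [hP', map_withDensity_comp P he hρ, hmap]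
  rw [← hend]
  refine (f.irrigationCost_le P' χ.fam_zero hα).trans ?_
  have hcc := concave_compare hα (f.measurable_mult P) (f.measurable_mult P') (f.mult_ne_top P)
    (f.mult_ne_top P') (f.compat f P P')
  refine hcc.trans (add_le_add ?_ ?_)
  · gcongr
    exact f.F_le_E P α
  · refine mul_le_mul_right ?_ _
    rw [f.lintegral_occ P' ((f.measurable_mult P).pow_const _)]
    calc _ ≤ ∫⁻ ω, f.zt P α ω (f.T ω) ∂P' := lintegral_mono fun ω => f.zt_im_le P α ω
      _ = ∫⁻ ω, ρ (f.γ ω (f.T ω)) * f.zt P α ω (f.T ω) ∂P := by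
        rw [hP', lintegral_withDensity_eq_lintegral_mul _ hρe (f.measurable_z P α)]
        rfl
      _ = ∫⁻ ω, ρ (f.γ ω (f.T ω)) * χ.landscape α (f.γ ω (f.T ω)) ∂P := by
        refine lintegral_congr_ae ?_
        filter_upwards [χ.landscape_end hα hE hopt] with ω hω
        rw [hω]
      _ = ∫⁻ x, ρ x * χ.landscape α x ∂μ := by
        exact (lintegral_end χ (hρ.mul (χ.measurable_landscape α))).symm

theorem main_result {d : ℕ} (α : ℝ) (hα : α ∈ Ioo (0 : ℝ) 1)
    (μ : Measure (Euc d)) [IsFiniteMeasure μ] (hirr : irrigationCost α μ ≠ ⊤)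
    (χ : IrrigationPlan μ) (hopt : χ.IsOptimal α)
    (g : Euc d → ℝ) (hg : Measurable g) (hg1 : ∀ᵐ x ∂μ, |g x| ≤ 1) :
    irrigationCost α (μ.withDensity fun x => ENNReal.ofReal (1 + g x)) ≤
      ENNReal.ofReal ((irrigationCost α μ).toReal
        + α * ∫ x, (χ.landscape α x).toReal * g x ∂μ) := by
  have hEI : χ.fam.E χ.par α = irrigationCost α μ := by rw [← χ.fam_cost]; exact hopt
  have hE : χ.fam.E χ.par α ≠ ⊤ := by rwa [hEI]
  have hρ : Measurable fun x => ENNReal.ofReal (1 + g x) := (hg.const_add 1).ennreal_ofReal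
  have hfin : ∫⁻ x, ENNReal.ofReal (1 + g x) ∂μ ≠ ⊤ := by
    refine ne_top_of_le_ne_top (b := ∫⁻ _, 2 ∂μ) ?_ (lintegral_mono_ae ?_)
    · rw [lintegral_const]; exact ENNReal.mul_ne_top (by norm_num) (measure_ne_top _ _)
    · filter_upwards [hg1] with x hx
      rw [← ENNReal.ofReal_ofNat]
      exact ENNReal.ofReal_le_ofReal (by linarith [(abs_le.1 hx).2])
  have hZm := χ.measurable_landscape α
  have hZI : ∫⁻ x, χ.landscape α x ∂μ = irrigationCost α μ := by
    rw [lintegral_end χ hZm, ← hEI, Fam.E]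
    exact lintegral_congr_ae (χ.landscape_end hα hE hEI.le)
  have hZfin : ∀ᵐ x ∂μ, χ.landscape α x < ⊤ := ae_lt_top hZm (by rwa [hZI])
  have hZint : Integrable (fun x => (χ.landscape α x).toReal) μ :=
    integrable_toReal_of_lintegral_ne_top hZm.aemeasurable (by rwa [hZI])
  have hZgint : Integrable (fun x => (χ.landscape α x).toReal * g x) μ := by
    refine hZint.mono (hZm.ennreal_toReal.mul hg).aestronglyMeasurable ?_
    filter_upwards [hg1] with x hx
    rw [norm_mul]
    exact mul_le_of_le_one_right (norm_nonneg _) hx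
  have hI : ∫ x, (χ.landscape α x).toReal ∂μ = (irrigationCost α μ).toReal := by
    rw [integral_toReal hZm.aemeasurable hZfin, hZI]
  have hnn : ∀ᵐ x ∂μ, 0 ≤ (χ.landscape α x).toReal + (χ.landscape α x).toReal * g x := by
    filter_upwards [hg1] with x hx
    have := (abs_le.1 hx).1
    nlinarith [ENNReal.toReal_nonneg (a := χ.landscape α x)]
  have hA : ∫⁻ x, ENNReal.ofReal (1 + g x) * χ.landscape α x ∂μ =
      ENNReal.ofReal ((irrigationCost α μ).toReal + ∫ x, (χ.landscape α x).toReal * g x ∂μ) := by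
    rw [← hI, ← integral_add hZint hZgint, ofReal_integral_eq_lintegral_ofReal
      (f := fun x => (χ.landscape α x).toReal + (χ.landscape α x).toReal * g x)
      (hZint.add hZgint) hnn]
    refine lintegral_congr_ae ?_
    filter_upwards [hZfin, hg1] with x hx hgx
    have h1 : 0 ≤ 1 + g x := by linarith [(abs_le.1 hgx).1]
    conv_lhs => rw [← ENNReal.ofReal_toReal hx.ne, ← ENNReal.ofReal_mul h1]
    congr 1; ring
  have hApos : 0 ≤ (irrigationCost α μ).toReal + ∫ x, (χ.landscape α x).toReal * g x ∂μ := by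
    rw [← hI, ← integral_add hZint hZgint]
    exact integral_nonneg_of_ae hnn
  have h := perturb_aux α hα μ χ hE hEI.le _ hρ hfin
  refine h.trans (le_of_eq ?_)
  rw [hA, hEI]
  conv_lhs => rw [← ENNReal.ofReal_toReal hirr]
  have h1α : 0 ≤ 1 - α := by linarith [hα.2]
  rw [ENNReal.toReal_ofReal ENNReal.toReal_nonneg, ← ENNReal.ofReal_mul h1α,
    ← ENNReal.ofReal_mul hα.1.le, ← ENNReal.ofReal_add
    (mul_nonneg h1α ENNReal.toReal_nonneg) (mul_nonneg hα.1.le hApos)]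
  congr 1; ring

/-- Let `α ∈ (0,1)`, let `μ` be an α-irrigable positive bounded Radon measure on `ℝ^d`
with landscape function `Z` associated to an optimal irrigation plan `χ`, and let `g` be
measurable with `|g| ≤ 1` μ-a.e.  Then the positive measure `ν = (1+g)μ` satisfies
`I^α(ν) ≤ I^α(μ) + α ∫ Z g dμ`. -/
theorem irrigationCost_perturbation {d : ℕ} (α : ℝ) (hα : α ∈ Ioo (0 : ℝ) 1)
    (μ : Measure (Euc d)) [IsFiniteMeasure μ] (hirr : irrigationCost α μ ≠ ⊤)
    (χ : IrrigationPlan μ) (hopt : χ.IsOptimal α)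
    (g : Euc d → ℝ) (hg : Measurable g) (hg1 : ∀ᵐ x ∂μ, |g x| ≤ 1) :
    irrigationCost α (μ.withDensity fun x => ENNReal.ofReal (1 + g x)) ≤
      ENNReal.ofReal ((irrigationCost α μ).toReal
        + α * ∫ x, (χ.landscape α x).toReal * g x ∂μ) := by
  exact main_result α hα μ hirr χ hopt g hg hg1
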